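/- Suppose [·,·] is a Lie bracket on ℝ^7 and Λ : ℝ^7 → 𝔤𝔩(7,ℝ) is a linear map with Λ(x)y − Λ(y)x = [x,y] and Λ(x) ∈ 𝔤₂* for all x,y ∈ ℝ^7, and suppose the infinitesimal holonomy 𝔥 equals 𝔞 ⋉ 𝔪(1,0,k), one of the listed type III algebras, with 𝔞 ≠ 0. Then Λ(e_4) ∈ 𝔥^III and pro_A(Λ(e_4)) = 0, i.e. Λ(e_4) = h(0, v, y) for some v ∈ ℝ, y ∈ ℝ². -/

import Mathlib

open Matrix

noncomputable section

abbrev V7 : Type := Fin 7 → ℝ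
abbrev M7 : Type := Matrix (Fin 7) (Fin 7) ℝ
abbrev M2 : Type := Matrix (Fin 2) (Fin 2) ℝ

/-- The standard basis of `ℝ^7` (0-indexed: `e 0` is `e_1` of the paper). -/
def e (i : Fin 7) : V7 := Pi.single i 1

/-- The matrix `X(s)` (indices shifted: `s 0 = s_1`, …, `s 13 = s_14`). -/
def Xg2 (s : Fin 14 → ℝ) : M7 :=
  !![s 0 + s 3, -s 9, s 8, Real.sqrt 2 * s 5, 0, -s 10, -s 11;
     -s 7, s 0, s 1, Real.sqrt 2 * s 8, s 10, 0, s 5;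
     s 6, s 2, s 3, Real.sqrt 2 * s 9, s 11, -s 5, 0;
     Real.sqrt 2 * s 4, Real.sqrt 2 * s 6, Real.sqrt 2 * s 7, 0,
       Real.sqrt 2 * s 5, Real.sqrt 2 * s 8, Real.sqrt 2 * s 9;
     0, s 12, s 13, Real.sqrt 2 * s 4, -s 0 - s 3, s 7, -s 6;
     -s 12, 0, -s 4, Real.sqrt 2 * s 6, s 9, -s 0, -s 2;
     -s 13, s 4, 0, Real.sqrt 2 * s 7, -s 8, -s 1, -s 3]

/-- `𝔤₂* = {X(s) : s ∈ ℝ^14}`. -/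
def g2star : Set M7 := Set.range Xg2

/-- The matrix `h(A,v,u,y)`. -/
def hmat (A : M2) (v : ℝ) (u y : Fin 2 → ℝ) : M7 :=
  !![A 0 0 + A 1 1, -u 1, u 0, Real.sqrt 2 * v, 0, -y 0, -y 1;
     0, A 0 0, A 0 1, Real.sqrt 2 * u 0, y 0, 0, v;
     0, A 1 0, A 1 1, Real.sqrt 2 * u 1, y 1, -v, 0;
     0, 0, 0, 0, Real.sqrt 2 * v, Real.sqrt 2 * u 0, Real.sqrt 2 * u 1;
     0, 0, 0, 0, -(A 0 0 + A 1 1), 0, 0;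
     0, 0, 0, 0, u 1, -A 0 0, -A 1 0;
     0, 0, 0, 0, -u 0, -A 0 1, -A 1 1]

/-- `𝔥^I = {h(A,v,u,y)}`. -/
def hI : Set M7 := {X | ∃ A v u y, X = hmat A v u y}

/-- The matrix `h(A,v,y) := h(A,v,0,y)`. -/
def h3 (A : M2) (v : ℝ) (y : Fin 2 → ℝ) : M7 := hmat A v 0 y

/-- `𝔥^III = {h(A,v,y)}`. -/
def hIII : Set M7 := {X | ∃ A v y, X = h3 A v y}

/-- `𝔪(1,0,1) = {h(0,v,(y_1,0))}`. -/
def m101 : Set M7 := {X | ∃ v y1, X = h3 0 v ![y1, 0]}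

/-- `𝔪(1,0,2) = {h(0,v,(y_1,y_2))}`. -/
def m102 : Set M7 := {X | ∃ v y, X = h3 0 v y}

/-- The projection `pro_A` (reading off the relevant entries; on `𝔥^III` and `𝔥^I`
it gives the `𝔤𝔩(2,ℝ)`-component `A`). -/
def proA (X : M7) : M2 := !![X 1 1, X 1 2; X 2 1, X 2 2]

/-- The projection `pro_v` (on `𝔥^III` and `𝔥^I` it gives the component `v`). -/
def proV (X : M7) : ℝ := X 1 6

/-- The curvature `R(x,y) = Λ(x)Λ(y) − Λ(y)Λ(x) − Λ([x,y])`. -/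
def curv (L : V7 →ₗ[ℝ] M7) (bk : V7 → V7 → V7) (x y : V7) : M7 :=
  L x * L y - L y * L x - L (bk x y)

/-- The infinitesimal holonomy: the smallest linear subspace of `𝔤𝔩(7,ℝ)` containing
all `R(x,y)` and stable under bracketing with all `Λ(z)`. -/
def infHol (L : V7 →ₗ[ℝ] M7) (bk : V7 → V7 → V7) : Submodule ℝ M7 :=
  sInf {H : Submodule ℝ M7 | (∀ x y, curv L bk x y ∈ H) ∧
    ∀ z : V7, ∀ X ∈ H, L z * X - X * L z ∈ H}

/-- `𝔰𝔩(2,ℝ)` as a set of 2×2 matrices. -/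
def sl2 : Set M2 := {A | A 0 0 + A 1 1 = 0}

/-- `𝔤𝔩(2,ℝ)` as a set of 2×2 matrices. -/
def gl2 : Set M2 := Set.univ

/-- `𝔠𝔬(2) = {(a,−b;b,a)}`. -/
def co2 : Set M2 := {A | ∃ a b : ℝ, A = !![a, -b; b, a]}

/-- `𝔡`, the diagonal 2×2 matrices. -/
def dd : Set M2 := {A | A 0 1 = 0 ∧ A 1 0 = 0}

/-- `ℝ·diag(1,0)`. -/
def rdiag10 : Set M2 := {A | ∃ t : ℝ, A = !![t, 0; 0, 0]}

/-- `𝔞 ⋉ 𝔪(1,0,k)`. -/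
def semidir (a : Set M2) : ℕ → Set M7
  | 1 => {X | ∃ A ∈ a, ∃ v y1, X = h3 A v ![y1, 0]}
  | _ => {X | ∃ A ∈ a, ∃ v y, X = h3 A v y}

/-- The pairs `(𝔞, k)` occurring in the list of type III holonomy algebras. -/
def ListedPair (a : Set M2) (k : ℕ) : Prop :=
  ((a = sl2 ∨ a = gl2 ∨ a = co2 ∨ a = dd) ∧ k = 2) ∨
  ((a = ({0} : Set M2) ∨ a = rdiag10) ∧ (k = 1 ∨ k = 2))

/-- The listed type III holonomy algebras `𝔞 ⋉ 𝔪(1,0,k)`. -/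
def ListedTypeIII (S : Set M7) : Prop := ∃ a k, ListedPair a k ∧ S = semidir a k

/-- The curvature of `L` computed with the torsion-free bracket `L x y - L y x`. -/
def cv (L : V7 →ₗ[ℝ] M7) (x y : V7) : M7 :=
  L x * L y - L y * L x - L (L x *ᵥ y - L y *ᵥ x)

/-- The curvature takes values in `𝔥^III` and satisfies the first Bianchi identity. -/
structure CurvIII (L : V7 →ₗ[ℝ] M7) : Prop where
  mem : ∀ x y, cv L x y ∈ hIII
  bianchi : ∀ x y z, cv L x y *ᵥ z + cv L y z *ᵥ x + cv L z x *ᵥ y = 0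

lemma cv_swap (L : V7 →ₗ[ℝ] M7) (x y : V7) : cv L x y = -cv L y x := by
  have h : L y *ᵥ x - L x *ᵥ y = -(L x *ᵥ y - L y *ᵥ x) := by abel
  rw [cv, cv, h, map_neg]
  abel

lemma mulVec_e (M : M7) (i k : Fin 7) : (M *ᵥ e i) k = M k i := by
  simp [e]

lemma linear_eq_sum {W : Type*} [AddCommGroup W] [Module ℝ W] (f : V7 →ₗ[ℝ] W) (x : V7) :
    f x = ∑ i, x i • f (e i) := by
  conv_lhs => rw [← Finset.univ_sum_single x]
  rw [map_sum]
  refine Finset.sum_congr rfl fun i _ => ?_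
  rw [← map_smul]
  congr 1
  ext j
  simp [e, Pi.single_apply]

lemma cv_apply (L : V7 →ₗ[ℝ] M7) (i j k l : Fin 7) :
    cv L (e i) (e j) k l = (L (e i) * L (e j)) k l - (L (e j) * L (e i)) k l
      - ∑ m, (L (e i) m j - L (e j) m i) * L (e m) k l := by
  rw [cv, linear_eq_sum L (L (e i) *ᵥ e j - L (e j) *ᵥ e i)]
  simp only [Matrix.sub_apply, Matrix.sum_apply, Matrix.smul_apply, Pi.sub_apply, mulVec_e,
    smul_eq_mul]

lemma bianchi_of_jacobi {L : V7 →ₗ[ℝ] M7} {bk : V7 → V7 → V7}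
    (hbk : ∀ x y : V7, L x *ᵥ y - L y *ᵥ x = bk x y)
    (hjac : ∀ x y z : V7, bk (bk x y) z + bk (bk y z) x + bk (bk z x) y = 0) (x y z : V7) :
    cv L x y *ᵥ z + cv L y z *ᵥ x + cv L z x *ᵥ y = 0 := by
  have h := hjac x y z
  rw [← hbk (bk x y), ← hbk (bk y z), ← hbk (bk z x)] at h
  simp only [← hbk x y, ← hbk y z, ← hbk z x, Matrix.mulVec_sub, Matrix.mulVec_mulVec] at h
  simp only [cv, Matrix.sub_mulVec]
  rw [← neg_eq_zero, ← h]
  abel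

lemma CurvIII.coords {L : V7 →ₗ[ℝ] M7} (h : CurvIII L) :
    ∃ (A : Fin 7 → Fin 7 → M2) (v : Fin 7 → Fin 7 → ℝ) (y : Fin 7 → Fin 7 → Fin 2 → ℝ),
      (∀ i j, cv L (e i) (e j) = h3 (A i j) (v i j) (y i j)) ∧
      (∀ i j k l, h3 (A i j) (v i j) (y i j) l k + h3 (A j k) (v j k) (y j k) l i
        - h3 (A i k) (v i k) (y i k) l j = 0) := by
  choose A v y hA using fun i j : Fin 7 => h.mem (e i) (e j)
  refine ⟨A, v, y, hA, fun i j k l => ?_⟩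
  have hb := congrFun (h.bianchi (e i) (e j) (e k)) l
  rw [cv_swap L (e k) (e i)] at hb
  simp only [Pi.add_apply, Matrix.neg_mulVec, Pi.neg_apply, mulVec_e, Pi.zero_apply] at hb
  rw [← hA, ← hA, ← hA]
  linarith

lemma proA_h3 (A : M2) (v : ℝ) (y : Fin 2 → ℝ) : proA (h3 A v y) = A := by
  ext i j
  fin_cases i <;> fin_cases j <;> simp [proA, h3, hmat]

lemma mat2_eq_zero {A : M2} (h00 : A 0 0 = 0) (h01 : A 0 1 = 0) (h10 : A 1 0 = 0)
    (h11 : A 1 1 = 0) : A = 0 := by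
  ext i j
  fin_cases i <;> fin_cases j <;> simpa

/-- The `𝔤𝔩(2)`-part of the curvature vanishes on the span of `e_1, e_2, e_3, e_4, e_5`. -/
lemma CurvIII.proA_eq_zero {L : V7 →ₗ[ℝ] M7} (h : CurvIII L) {i j : Fin 7}
    (hi : i < 5) (hj : j < 5) : proA (cv L (e i) (e j)) = 0 := by
  obtain ⟨A, v, y, hA, hb⟩ := h.coords
  have hcol : ∀ (A : M2) (v : ℝ) (y : Fin 2 → ℝ) (i : Fin 7), i < 5 →
      h3 A v y 5 i = 0 ∧ h3 A v y 6 i = 0 := by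
    intro A v y i hi
    fin_cases i <;> simp [h3, hmat] at hi ⊢
  have key : ∀ k, h3 (A i j) (v i j) (y i j) 5 k = 0 ∧ h3 (A i j) (v i j) (y i j) 6 k = 0 := by
    intro k
    have h5 := hb i j k 5
    have h6 := hb i j k 6
    rw [(hcol _ _ _ i hi).1, (hcol _ _ _ j hj).1] at h5
    rw [(hcol _ _ _ i hi).2, (hcol _ _ _ j hj).2] at h6
    exact ⟨by linarith, by linarith⟩
  have h5 := key 5
  have h6 := key 6
  simp only [h3, hmat] at h5 h6
  simp at h5 h6
  rw [hA, proA_h3]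
  exact mat2_eq_zero h5.1 h5.2 h6.1 h6.2

lemma CurvIII.proA_zero_dual {L : V7 →ₗ[ℝ] M7} (h : CurvIII L) :
    proA (cv L (e 0) (e 5)) = 0 ∧ proA (cv L (e 0) (e 6)) = 0 := by
  obtain ⟨A, v, y, hA, hb⟩ := h.coords
  simp only [hA, proA_h3]
  have b0 := hb 0 1 5 1
  have b1 := hb 0 2 5 1
  have b2 := hb 0 1 5 2
  have b3 := hb 0 1 6 1
  have b4 := hb 0 5 6 5
  have b5 := hb 0 4 5 4
  have b6 := hb 0 2 6 2
  have b7 := hb 0 4 6 4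
  have b8 := hb 0 5 6 6
  have b9 := hb 0 1 6 2
  simp [h3, hmat] at b0 b1 b2 b3 b4 b5 b6 b7 b8 b9
  exact ⟨mat2_eq_zero (by linarith) (by linarith) (by linarith) (by linarith),
    mat2_eq_zero (by linarith) (by linarith) (by linarith) (by linarith)⟩

lemma CurvIII.proA_three_dual {L : V7 →ₗ[ℝ] M7} (h : CurvIII L) :
    proA (cv L (e 3) (e 5)) = 0 ∧ proA (cv L (e 3) (e 6)) = 0 := by
  obtain ⟨A, v, y, hA, hb⟩ := h.coords
  simp only [hA, proA_h3]
  have b0 := hb 1 3 5 1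
  have b1 := hb 2 3 5 1
  have b2 := hb 2 3 6 2
  have b3 := hb 3 4 6 4
  have b4 := hb 3 5 6 5
  have b5 := hb 3 4 5 4
  have b6 := hb 3 5 6 6
  have b7 := hb 1 3 6 2
  simp [h3, hmat] at b0 b1 b2 b3 b4 b5 b6 b7
  exact ⟨mat2_eq_zero (by linarith) (by linarith) (by linarith) (by linarith),
    mat2_eq_zero (by linarith) (by linarith) (by linarith) (by linarith)⟩

/-- Symmetries of the `𝔤𝔩(2)`-part of the curvature on `E ∧ E*`. -/
lemma CurvIII.proA_mixed {L : V7 →ₗ[ℝ] M7} (h : CurvIII L) :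
    let W := fun i j : Fin 7 => proA (cv L (e i) (e j))
    (W 1 5 0 0 + W 1 5 1 1 = 0 ∧ W 1 6 0 0 + W 1 6 1 1 = 0 ∧
      W 2 5 0 0 + W 2 5 1 1 = 0 ∧ W 2 6 0 0 + W 2 6 1 1 = 0) ∧
    (W 1 5 + W 2 6 = 0) ∧
    (W 1 5 0 1 = W 2 5 0 0 ∧ W 1 5 1 1 = W 2 5 1 0 ∧ W 1 6 0 1 = W 2 6 0 0 ∧
      W 1 6 1 1 = W 2 6 1 0) ∧
    (W 1 5 1 0 = W 1 6 0 0 ∧ W 1 5 1 1 = W 1 6 0 1 ∧ W 2 5 1 0 = W 2 6 0 0 ∧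
      W 2 5 1 1 = W 2 6 0 1) := by
  obtain ⟨A, v, y, hA, hb⟩ := h.coords
  simp only [hA, proA_h3]
  have b0 := hb 1 4 5 4
  have b1 := hb 1 4 6 4
  have b2 := hb 2 4 5 4
  have b3 := hb 2 4 6 4
  have b4 := hb 1 5 6 6
  have b5 := hb 1 5 6 5
  have b6 := hb 2 5 6 5
  have b7 := hb 2 5 6 6
  have b8 := hb 1 2 6 1
  have b9 := hb 1 2 5 2
  have b10 := hb 1 2 5 1
  have b11 := hb 1 2 6 2
  simp [h3, hmat] at b0 b1 b2 b3 b4 b5 b6 b7 b8 b9 b10 b11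
  refine ⟨⟨by linarith, by linarith, by linarith, by linarith⟩,
    mat2_eq_zero ?_ ?_ ?_ ?_, ⟨by linarith, by linarith, by linarith, by linarith⟩,
    ⟨by linarith, by linarith, by linarith, by linarith⟩⟩ <;>
    simp only [Matrix.add_apply] <;> linarith

lemma CurvIII.proA_last {L : V7 →ₗ[ℝ] M7} (h : CurvIII L) :
    (proA (cv L (e 4) (e 5)) 1 0 = proA (cv L (e 4) (e 6)) 0 0) ∧
    (proA (cv L (e 4) (e 5)) 1 1 = proA (cv L (e 4) (e 6)) 0 1) := by
  obtain ⟨A, v, y, hA, hb⟩ := h.coords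
  simp only [hA, proA_h3]
  have b0 := hb 4 5 6 5
  have b1 := hb 4 5 6 6
  simp [h3, hmat] at b0 b1
  exact ⟨by linarith, by linarith⟩

/-- If the `𝔤𝔩(2)`-part of the curvature vanishes on `E ∧ E*`, it vanishes on `E* ∧ E*`. -/
lemma CurvIII.proA_dual_dual {L : V7 →ₗ[ℝ] M7} (h : CurvIII L)
    (_ : proA (cv L (e 1) (e 5)) = 0) (_ : proA (cv L (e 1) (e 6)) = 0)
    (_ : proA (cv L (e 2) (e 5)) = 0) (_ : proA (cv L (e 2) (e 6)) = 0) :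
    proA (cv L (e 5) (e 6)) = 0 := by
  obtain ⟨A, v, y, hA, hb⟩ := h.coords
  simp only [hA, proA_h3] at *
  have c0 := hb 1 4 5 3
  have c1 := hb 1 4 6 3
  have c2 := hb 2 4 5 3
  have c3 := hb 2 4 6 3
  simp [h3, hmat] at c0 c1 c2 c3
  have b0 := hb 1 5 6 1
  have b1 := hb 2 5 6 1
  have b2 := hb 1 5 6 2
  have b3 := hb 2 5 6 2
  simp [h3, hmat] at b0 b1 b2 b3
  exact mat2_eq_zero (by linarith) (by linarith) (by linarith) (by linarith)

lemma proA_hmat (A : M2) (v : ℝ) (u y : Fin 2 → ℝ) : proA (hmat A v u y) = A := by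
  ext i j
  fin_cases i <;> fin_cases j <;> simp [proA, hmat]

lemma proA_hmat_mul (A B : M2) (v w : ℝ) (u y s z : Fin 2 → ℝ) :
    proA (hmat A v u y * hmat B w s z) = A * B := by
  ext i j
  fin_cases i <;> fin_cases j <;>
    simp [proA, hmat, Matrix.mul_apply, Fin.sum_univ_succ]

lemma proA_sub (X Y : M7) : proA (X - Y) = proA X - proA Y := by
  ext i j
  fin_cases i <;> fin_cases j <;> simp [proA]

lemma proA_add (X Y : M7) : proA (X + Y) = proA X + proA Y := by
  ext i j
  fin_cases i <;> fin_cases j <;> simp [proA]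

lemma proA_smul (r : ℝ) (X : M7) : proA (r • X) = r • proA X := by
  ext i j
  fin_cases i <;> fin_cases j <;> simp [proA]

lemma proA_zero : proA 0 = 0 := by
  ext i j
  fin_cases i <;> fin_cases j <;> simp [proA]

lemma proA_sum (f : Fin 7 → M7) : proA (∑ i, f i) = ∑ i, proA (f i) := by
  simp [Fin.sum_univ_succ, proA_add]

lemma proA_cv {L : V7 →ₗ[ℝ] M7} {A : Fin 7 → M2} {v : Fin 7 → ℝ} {u y : Fin 7 → Fin 2 → ℝ}
    (hL : ∀ i, L (e i) = hmat (A i) (v i) (u i) (y i)) (i j : Fin 7) :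
    proA (cv L (e i) (e j)) = A i * A j - A j * A i
      - ∑ m, (hmat (A i) (v i) (u i) (y i) m j - hmat (A j) (v j) (u j) (y j) m i) • A m := by
  rw [cv, linear_eq_sum L (L (e i) *ᵥ e j - L (e j) *ᵥ e i)]
  simp only [proA_sub, proA_sum, proA_smul, Pi.sub_apply, mulVec_e]
  simp only [hL, proA_hmat_mul, proA_hmat]

/-- The equations on the components of a torsion-free connection with values in `𝔥^III` which
follow from the first Bianchi identity. -/
structure GConn (A : Fin 7 → M2) (v : Fin 7 → ℝ) (y : Fin 7 → Fin 2 → ℝ) : Prop where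
  z1 : A 0 * A 1 - A 1 * A 0 = A 0 0 0 • A 1 + A 0 1 0 • A 2 - (A 1 0 0 + A 1 1 1) • A 0
  z2 : A 0 * A 2 - A 2 * A 0 = A 0 0 1 • A 1 + A 0 1 1 • A 2 - (A 2 0 0 + A 2 1 1) • A 0
  z3 : A 0 * A 3 - A 3 * A 0 = (√2 * v 0 - (A 3 0 0 + A 3 1 1)) • A 0
  z4 : A 0 * A 4 - A 4 * A 0 = y 0 0 • A 1 + y 0 1 • A 2 + (√2 * v 0) • A 3
    - (A 0 0 0 + A 0 1 1) • A 4 - (A 4 0 0 + A 4 1 1) • A 0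
  z5 : A 0 * A 5 - A 5 * A 0 = -(v 0 • A 2) - A 0 0 0 • A 5 - A 0 0 1 • A 6
    - (y 0 0 + (A 5 0 0 + A 5 1 1)) • A 0
  z6 : A 0 * A 6 - A 6 * A 0 = v 0 • A 1 - A 0 1 0 • A 5 - A 0 1 1 • A 6
    - (y 0 1 + (A 6 0 0 + A 6 1 1)) • A 0
  t1 : A 3 * A 1 - A 1 * A 3 = A 3 0 0 • A 1 + A 3 1 0 • A 2 - (√2 * v 1) • A 0
  t2 : A 3 * A 2 - A 2 * A 3 = A 3 0 1 • A 1 + A 3 1 1 • A 2 - (√2 * v 2) • A 0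
  t4 : A 3 * A 4 - A 4 * A 3 = y 3 0 • A 1 + y 3 1 • A 2 + (√2 * v 3) • A 3
    - (A 3 0 0 + A 3 1 1) • A 4 - (√2 * v 4) • A 0
  t5 : A 3 * A 5 - A 5 * A 3 = -(v 3 • A 2) - A 3 0 0 • A 5 - A 3 0 1 • A 6
    - (y 3 0 + √2 * v 5) • A 0
  t6 : A 3 * A 6 - A 6 * A 3 = v 3 • A 1 - A 3 1 0 • A 5 - A 3 1 1 • A 6
    - (y 3 1 + √2 * v 6) • A 0
  flat : A 1 * A 2 - A 2 * A 1 = (A 1 0 1 - A 2 0 0) • A 1 + (A 1 1 1 - A 2 1 0) • A 2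
  f14 : A 1 * A 4 - A 4 * A 1 = (y 1 0 - A 4 0 0) • A 1 + (y 1 1 - A 4 1 0) • A 2
    + (√2 * v 1) • A 3 - (A 1 0 0 + A 1 1 1) • A 4
  f24 : A 2 * A 4 - A 4 * A 2 = (y 2 0 - A 4 0 1) • A 1 + (y 2 1 - A 4 1 1) • A 2
    + (√2 * v 2) • A 3 - (A 2 0 0 + A 2 1 1) • A 4
  mixed : ∃ W11 W12 W21 W22 : M2,
    A 1 * A 5 - A 5 * A 1 = W11 - y 1 0 • A 0 - A 5 0 0 • A 1 - (v 1 + A 5 1 0) • A 2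
      - A 1 0 0 • A 5 - A 1 0 1 • A 6 ∧
    A 1 * A 6 - A 6 * A 1 = W12 - y 1 1 • A 0 + (v 1 - A 6 0 0) • A 1 - A 6 1 0 • A 2
      - A 1 1 0 • A 5 - A 1 1 1 • A 6 ∧
    A 2 * A 5 - A 5 * A 2 = W21 - y 2 0 • A 0 - A 5 0 1 • A 1 - (v 2 + A 5 1 1) • A 2
      - A 2 0 0 • A 5 - A 2 0 1 • A 6 ∧
    A 2 * A 6 - A 6 * A 2 = W22 - y 2 1 • A 0 + (v 2 - A 6 0 1) • A 1 - A 6 1 1 • A 2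
      - A 2 1 0 • A 5 - A 2 1 1 • A 6 ∧
    (W11 0 0 + W11 1 1 = 0 ∧ W12 0 0 + W12 1 1 = 0 ∧ W21 0 0 + W21 1 1 = 0 ∧
      W22 0 0 + W22 1 1 = 0) ∧ W11 + W22 = 0 ∧
    (W11 0 1 = W21 0 0 ∧ W11 1 1 = W21 1 0 ∧ W12 0 1 = W22 0 0 ∧ W12 1 1 = W22 1 0) ∧
    (W11 1 0 = W12 0 0 ∧ W11 1 1 = W12 0 1 ∧ W21 1 0 = W22 0 0 ∧ W21 1 1 = W22 0 1)
  v03 : (A 0 0 0 + A 0 1 1) * v 3 = √2 * v 0 * v 0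
  v23 : (A 3 0 0 + A 3 1 1) * v 2 - (A 2 0 0 + A 2 1 1) * v 3
    = A 3 0 1 * v 1 + A 3 1 1 * v 2 - √2 * v 2 * v 0
  v12 : (A 1 0 0 + A 1 1 1) * v 2 - (A 2 0 0 + A 2 1 1) * v 1
    = (A 1 0 1 - A 2 0 0) * v 1 + (A 1 1 1 - A 2 1 0) * v 2
  y06 : A 0 1 0 * y 6 0 + A 0 1 1 * y 6 1 + (A 0 0 0 + A 0 1 1) * y 6 1
    - (A 6 1 0 * y 0 0 + A 6 1 1 * y 0 1 + (A 6 0 0 + A 6 1 1) * y 0 1)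
    = v 0 * y 1 1 - A 0 1 0 * y 5 1 - A 0 1 1 * y 6 1 - (y 0 1 + (A 6 0 0 + A 6 1 1)) * y 0 1

lemma CurvIII.gConn {L : V7 →ₗ[ℝ] M7} (h : CurvIII L) {A : Fin 7 → M2} {v : Fin 7 → ℝ}
    {y : Fin 7 → Fin 2 → ℝ} (hL : ∀ i, L (e i) = h3 (A i) (v i) (y i)) : GConn A v y := by
  have hP := proA_cv (u := 0) hL
  have hz : ∀ i j : Fin 7, i < 5 → j < 5 → _ = (0 : M2) := fun i j hi hj =>
    (hP i j).symm.trans (h.proA_eq_zero hi hj)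
  have h01 := hz 0 1 (by decide) (by decide)
  have h02 := hz 0 2 (by decide) (by decide)
  have h03 := hz 0 3 (by decide) (by decide)
  have h04 := hz 0 4 (by decide) (by decide)
  have h05 := (hP 0 5).symm.trans h.proA_zero_dual.1
  have h06 := (hP 0 6).symm.trans h.proA_zero_dual.2
  have h31 := hz 3 1 (by decide) (by decide)
  have h32 := hz 3 2 (by decide) (by decide)
  have h34 := hz 3 4 (by decide) (by decide)
  have h35 := (hP 3 5).symm.trans h.proA_three_dual.1
  have h36 := (hP 3 6).symm.trans h.proA_three_dual.2
  have h12 := hz 1 2 (by decide) (by decide)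
  have h14 := hz 1 4 (by decide) (by decide)
  have h24 := hz 2 4 (by decide) (by decide)
  have h15 := hP 1 5
  have h16 := hP 1 6
  have h25 := hP 2 5
  have h26 := hP 2 6
  simp [hmat, Fin.sum_univ_succ] at h01 h02 h03 h04 h05 h06 h31 h32 h34 h35 h36 h12 h14 h24
  simp [hmat, Fin.sum_univ_succ] at h15 h16 h25 h26
  obtain ⟨C, c, z, hC, hb⟩ := h.coords
  have hv : ∀ i j, c i j = cv L (e i) (e j) 1 6 := fun i j => by rw [hC]; simp [h3, hmat]
  have hy : ∀ i j, z i j 1 = cv L (e i) (e j) 2 4 := fun i j => by rw [hC]; simp [h3, hmat]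
  have b03 := hb 0 3 4 3
  have b23 := hb 2 3 4 3
  have b12 := hb 1 2 3 0
  have b06 := hb 0 4 6 2
  simp [h3, hmat] at b03 b23 b12 b06
  rw [hv] at b03 b23 b12
  rw [hy] at b06
  simp only [cv_apply, hL, h3, hmat, Matrix.mul_apply, Fin.sum_univ_succ] at b03 b23 b12 b06
  simp at b03 b23 b12 b06
  constructor
  case mixed =>
    refine ⟨_, _, _, _, ?_, ?_, ?_, ?_, h.proA_mixed⟩
    · linear_combination (norm := module) -h15
    · linear_combination (norm := module) -h16
    · linear_combination (norm := module) -h25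
    · linear_combination (norm := module) -h26
  case v03 => linear_combination b03
  case v23 => linear_combination -b23
  case v12 => linear_combination b12
  case y06 => linear_combination b06
  · linear_combination (norm := module) h01
  · linear_combination (norm := module) h02
  · linear_combination (norm := module) h03
  · linear_combination (norm := module) h04
  · linear_combination (norm := module) h05
  · linear_combination (norm := module) h06
  · linear_combination (norm := module) h31
  · linear_combination (norm := module) h32
  · linear_combination (norm := module) h34
  · linear_combination (norm := module) h35
  · linear_combination (norm := module) h36
  · linear_combination (norm := module) h12
  · linear_combination (norm := module) h14
  · linear_combination (norm := module) h24

/-- `Z` is not a scalar matrix. -/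
def IsNonScalar (Z : M2) : Prop := Z 0 1 ≠ 0 ∨ Z 1 0 ≠ 0 ∨ Z 0 0 ≠ Z 1 1

lemma ad_cube (S X : M2) :
    S * (S * (S * X - X * S) - (S * X - X * S) * S) - (S * (S * X - X * S) - (S * X - X * S) * S) * S
      = ((S 0 0 + S 1 1) ^ 2 - 4 * (S 0 0 * S 1 1 - S 0 1 * S 1 0)) • (S * X - X * S) := by
  ext i j
  fin_cases i <;> fin_cases j <;> simp [Matrix.mul_apply, Fin.sum_univ_two] <;> ring

lemma ad_pair_eq_zero {S X Y P Q : M2} {p q r s k l : ℝ}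
    (h1 : S * X - X * S = p • X + q • Y + k • S + P)
    (h2 : S * Y - Y * S = r • X + s • Y + l • S + Q) (hP : S * P = P * S) (hQ : S * Q = Q * S)
    (hdet : (p ^ 2 + q * r - ((S 0 0 + S 1 1) ^ 2 - 4 * (S 0 0 * S 1 1 - S 0 1 * S 1 0))) *
      (s ^ 2 + q * r - ((S 0 0 + S 1 1) ^ 2 - 4 * (S 0 0 * S 1 1 - S 0 1 * S 1 0))) -
        q * r * (p + s) ^ 2 ≠ 0) :
    S * X = X * S ∧ S * Y = Y * S := by
  set D := (S 0 0 + S 1 1) ^ 2 - 4 * (S 0 0 * S 1 1 - S 0 1 * S 1 0)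
  let T : M2 →ₗ[ℝ] M2 := LinearMap.mulLeft ℝ S - LinearMap.mulRight ℝ S
  have hT : ∀ X, T X = S * X - X * S := fun X => rfl
  have hX : T (T (T X)) = D • T X := ad_cube S X
  have hY : T (T (T Y)) = D • T Y := ad_cube S Y
  have hTS : T S = 0 := by rw [hT, sub_self]
  have hTP : T P = 0 := by rw [hT, hP, sub_self]
  have hTQ : T Q = 0 := by rw [hT, hQ, sub_self]
  rw [← hT] at h1 h2
  have h1' := congrArg T h1
  have h2' := congrArg T h2
  simp only [map_add, map_smul, hTS, hTP, hTQ, smul_zero, add_zero] at h1' h2'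
  have h1'' := congrArg T h1'
  have h2'' := congrArg T h2'
  simp only [map_add, map_smul] at h1'' h2''
  have e1 : p • (p • T X + q • T Y) + q • (r • T X + s • T Y) = D • T X := by
    rw [← hX, h1'', h1', h2']
  have e2 : r • (p • T X + q • T Y) + s • (r • T X + s • T Y) = D • T Y := by
    rw [← hY, h2'', h1', h2']
  have f1 : T X = 0 := by
    refine (smul_eq_zero.mp ?_).resolve_left hdet
    linear_combination (norm := module) (s ^ 2 + q * r - D) • e1 - (q * (p + s)) • e2
  have f2 : T Y = 0 := by
    refine (smul_eq_zero.mp ?_).resolve_left hdet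
    linear_combination (norm := module) (p ^ 2 + q * r - D) • e2 - (r * (p + s)) • e1
  exact ⟨sub_eq_zero.mp f1, sub_eq_zero.mp f2⟩

lemma ad_eq_zero {S X P : M2} {p k : ℝ} (h : S * X - X * S = p • X + k • S + P)
    (hP : S * P = P * S)
    (hp : p ^ 2 - ((S 0 0 + S 1 1) ^ 2 - 4 * (S 0 0 * S 1 1 - S 0 1 * S 1 0)) ≠ 0) :
    S * X = X * S := by
  have h' : S * X - X * S = p • X + (0 : ℝ) • X + k • S + P := by rw [h]; module
  have h'' : S * X - X * S = (0 : ℝ) • X + p • X + k • S + P := by rw [h]; module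
  refine (ad_pair_eq_zero h' h'' hP hP ?_).1
  intro hz
  exact hp (pow_eq_zero_iff (two_ne_zero) |>.mp (by linear_combination hz))

/-- The equations satisfied by the `𝔤𝔩(2)`-parts of the connection which involve the
adjoint action of a fixed component `S`. -/
structure AdEqs (S X Y B F P Q : M2) (m r s w b x₁ x₂ x₄ x₅ x₆ : ℝ) : Prop where
  eX : S * X - X * S = S 0 0 • X + S 1 0 • Y - x₁ • S
  eY : S * Y - Y * S = S 0 1 • X + S 1 1 • Y - x₂ • S
  eB : S * B - B * S = b • S
  eF : S * F - F * S = r • X + s • Y + w • B - (S 0 0 + S 1 1) • F - x₄ • S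
  eP : S * P - P * S = -(m • Y) - S 0 0 • P - S 0 1 • Q - x₅ • S
  eQ : S * Q - Q * S = m • X - S 1 0 • P - S 1 1 • Q - x₆ • S

section
variable {S X Y B F P Q : M2} {m r s w b x₁ x₂ x₄ x₅ x₆ : ℝ}

lemma AdEqs.commute_of_generic (h : AdEqs S X Y B F P Q m r s w b x₁ x₂ x₄ x₅ x₆)
    (hD : (S 0 0 + S 1 1) ^ 2 - 4 * (S 0 0 * S 1 1 - S 0 1 * S 1 0) ≠ 0)
    (hδ : S 0 0 * S 1 1 - S 0 1 * S 1 0 ≠ 0)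
    (h9 : 9 * (S 0 0 * S 1 1 - S 0 1 * S 1 0) - 2 * (S 0 0 + S 1 1) ^ 2 ≠ 0) :
    S * X = X * S ∧ S * Y = Y * S ∧ S * B = B * S ∧ S * F = F * S ∧ S * P = P * S ∧
      S * Q = Q * S := by
  have hdet := mul_ne_zero hδ h9
  obtain ⟨hX, hY⟩ := ad_pair_eq_zero (X := X) (Y := Y) (P := 0) (Q := 0)
    (k := -x₁) (l := -x₂) (p := S 0 0) (q := S 1 0) (r := S 0 1) (s := S 1 1)
    (by rw [h.eX]; module) (by rw [h.eY]; module) (by simp) (by simp)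
    (fun hz => hdet (by linear_combination hz))
  have hB := ad_eq_zero (X := B) (P := 0) (p := 0) (k := b) (by rw [h.eB]; module) (by simp)
    (fun hz => hD (by linear_combination -hz))
  have hF := ad_eq_zero (X := F) (P := r • X + s • Y + w • B) (p := -(S 0 0 + S 1 1)) (k := -x₄)
    (by rw [h.eF]; module) (by simp [mul_add, add_mul, hX, hY, hB])
    (fun hz => hδ (by linear_combination hz / 4))
  obtain ⟨hP, hQ⟩ := ad_pair_eq_zero (X := P) (Y := Q) (P := -(m • Y)) (Q := m • X)
    (k := -x₅) (l := -x₆) (p := -S 0 0) (q := -S 0 1) (r := -S 1 0) (s := -S 1 1)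
    (by rw [h.eP]; module) (by rw [h.eQ]; module) (by simp [hY]) (by simp [hX])
    (fun hz => hdet (by linear_combination hz))
  exact ⟨hX, hY, hB, hF, hP, hQ⟩

lemma AdEqs.commute_of_scalar (h : AdEqs S X Y B F P Q m r s w b x₁ x₂ x₄ x₅ x₆)
    {c : ℝ} (hc : c ≠ 0) (hS : S = c • 1) :
    ∃ Z : M2, IsNonScalar Z ∧ S * Z = Z * S ∧ X * Z = Z * X ∧ Y * Z = Z * Y ∧ B * Z = Z * B ∧
      F * Z = Z * F ∧ P * Z = Z * P ∧ Q * Z = Z * Q := by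
  have key : ∀ Z : M2, B * Z = Z * B → S * Z = Z * S ∧ X * Z = Z * X ∧ Y * Z = Z * Y ∧
      B * Z = Z * B ∧ F * Z = Z * F ∧ P * Z = Z * P ∧ Q * Z = Z * Q := by
    intro Z hZ
    have hX := h.eX
    have hY := h.eY
    have hF := h.eF
    have hP := h.eP
    have hQ := h.eQ
    simp [hS] at hX hY hF hP hQ
    have eX : X = x₁ • 1 := by
      refine smul_right_injective M2 hc ?_
      simp only
      linear_combination (norm := module) -hX
    have eY : Y = x₂ • 1 := by
      refine smul_right_injective M2 hc ?_
      simp only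
      linear_combination (norm := module) -hY
    have eP : P = (-m * x₂ / c - x₅) • 1 := by
      refine smul_right_injective M2 hc ?_
      simp only [smul_smul]
      rw [show c * (-m * x₂ / c - x₅) = -m * x₂ - c * x₅ by field_simp]
      rw [eY] at hP
      linear_combination (norm := module) hP
    have eQ : Q = (m * x₁ / c - x₆) • 1 := by
      refine smul_right_injective M2 hc ?_
      simp only [smul_smul]
      rw [show c * (m * x₁ / c - x₆) = m * x₁ - c * x₆ by field_simp]
      rw [eX] at hQ
      linear_combination (norm := module) hQ
    have eF : F = ((r * x₁ + s * x₂ - c * x₄) / (2 * c)) • 1 + (w / (2 * c)) • B := by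
      refine smul_right_injective M2 (mul_ne_zero two_ne_zero hc) ?_
      simp only [smul_smul, smul_add]
      rw [show 2 * c * ((r * x₁ + s * x₂ - c * x₄) / (2 * c)) = r * x₁ + s * x₂ - c * x₄ by
        field_simp, show 2 * c * (w / (2 * c)) = w by field_simp]
      rw [eX, eY] at hF
      linear_combination (norm := module) hF
    refine ⟨by simp [hS], by simp [eX], by simp [eY], hZ, ?_, by simp [eP], by simp [eQ]⟩
    simp [eF, mul_add, add_mul, hZ]
  by_cases hB : IsNonScalar B
  · exact ⟨B, hB, key B rfl⟩
  · refine ⟨!![0, 1; 0, 0], Or.inl (by simp), key _ ?_⟩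
    simp only [IsNonScalar, not_or, not_not] at hB
    ext i j
    fin_cases i <;> fin_cases j <;> simp [Matrix.mul_apply, Fin.sum_univ_two, hB]

end

lemma mat2_ext_iff {A B : M2} :
    A = B ↔ A 0 0 = B 0 0 ∧ A 0 1 = B 0 1 ∧ A 1 0 = B 1 0 ∧ A 1 1 = B 1 1 := by
  rw [← Matrix.ext_iff]
  simp [Fin.forall_fin_two, and_assoc]

section
variable {A : Fin 7 → M2} {v : Fin 7 → ℝ} {y : Fin 7 → Fin 2 → ℝ} {S : M2}
  {θ m r s w b x₁ x₂ x₄ x₅ x₆ : ℝ}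

/-- The case where `S` is diagonalizable of rank one. -/
lemma GConn.triangular_of_rank_one (h : GConn A v y)
    (hS : AdEqs S (A 1) (A 2) (A 3) (A 4) (A 5) (A 6) m r s w b x₁ x₂ x₄ x₅ x₆)
    (h0 : A 0 = θ • S) (hx₁ : x₁ = θ * (A 1 0 0 + A 1 1 1)) (hx₂ : x₂ = θ * (A 2 0 0 + A 2 1 1))
    (s00 : S 0 0 ≠ 0) (s01 : S 0 1 = 0) (s10 : S 1 0 = 0) (s11 : S 1 1 = 0) :
    (∀ i, A i 1 0 = 0) ∨ (∀ i, A i 0 1 = 0) := by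
  obtain ⟨e1, e2, e3, e4, e5, e6⟩ := hS
  have hf := h.flat
  have hF := h.f24
  have h0' := h0
  rw [mat2_ext_iff] at e1 e2 e3 e4 e5 e6 hf hF h0'
  simp [s01, s10, s11, Matrix.mul_apply, Fin.sum_univ_two] at e1 e2 e3 e4 e5 e6 hf hF h0'
  have X10 : A 1 1 0 = 0 := by grind
  have X11 : A 1 1 1 = 0 := by grind
  have Y01 : A 2 0 1 = 0 := by grind
  have Y10 : A 2 1 0 = 0 := by grind
  have B01 : A 3 0 1 = 0 := by grind
  have B10 : A 3 1 0 = 0 := by grind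
  have hθ : θ = 0 ∨ A 2 0 0 + A 2 1 1 = 0 := by
    have hx : x₂ * S 0 0 = 0 := by linear_combination e2.1
    exact mul_eq_zero.mp (hx₂ ▸ (mul_eq_zero.mp hx).resolve_right s00)
  by_cases hκ : A 1 0 1 = 0
  · right
    have F01 : A 4 0 1 = 0 := by grind
    have P01 : A 5 0 1 = 0 := by grind
    have Q01 : A 6 0 1 = 0 := by grind
    intro i
    fin_cases i <;> simp <;> grind
  · left
    have hd : A 2 1 1 = A 1 0 1 := by grind
    have hp : A 1 0 0 = 0 := by grind
    have hv := h.v12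
    have hv1 : v 1 = 0 := by grind
    obtain ⟨W, W', V, V', f1, f2, f3, f4, g⟩ := h.mixed
    have h' := g.2.1
    rw [mat2_ext_iff] at f1 f2 f3 f4 h'
    simp [Matrix.mul_apply, Fin.sum_univ_two, h0', X10, X11, Y01, Y10, hd, hp, hv1]
      at f1 f2 f3 f4 h'
    have Q11 : A 6 1 1 = 0 := by grind
    have P10 : A 5 1 0 = 0 := by grind
    have Q10 : A 6 1 0 = 0 := by grind
    have F10 : A 4 1 0 = 0 := by grind
    intro i
    fin_cases i <;> simp <;> grind

/-- The case where `S` is diagonalizable and one eigenvalue is twice the other one. -/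
lemma GConn.triangular_of_resonant (h : GConn A v y)
    (hS : AdEqs S (A 1) (A 2) (A 3) (A 4) (A 5) (A 6) m r s w b x₁ x₂ x₄ x₅ x₆)
    (h0 : A 0 = θ • S) (hx₁ : x₁ = θ * (A 1 0 0 + A 1 1 1)) (hx₂ : x₂ = θ * (A 2 0 0 + A 2 1 1))
    (hθ : θ = 0 ∨ θ = 1) (s01 : S 0 1 = 0) (s10 : S 1 0 = 0) (s11 : S 1 1 ≠ 0)
    (s00 : S 0 0 = 2 * S 1 1) :
    (∀ i, A i 1 0 = 0) ∨ (∀ i, A i 0 1 = 0) := by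
  obtain ⟨e1, e2, e3, e4, e5, e6⟩ := hS
  have h0' := h0
  rw [mat2_ext_iff] at e1 e2 e3 e4 e5 e6 h0'
  simp only [s01, s10, s00, Matrix.mul_apply, Fin.sum_univ_two, Matrix.sub_apply, Matrix.add_apply,
    Matrix.smul_apply, Matrix.neg_apply, smul_eq_mul] at e1 e2 e3 e4 e5 e6 h0'
  have cancel : ∀ x, S 1 1 * x = 0 → x = 0 := fun x hx => (mul_eq_zero.mp hx).resolve_left s11
  have hX : A 1 = 0 := by
    have h1 := cancel (A 1 0 0 - x₁) (by linear_combination -e1.1 / 2)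
    have h2 := cancel (2 * A 1 1 1 - x₁) (by linear_combination -e1.2.2.2)
    have h3 := cancel (A 1 0 1) (by linear_combination -e1.2.1)
    have h4 := cancel (A 1 1 0) (by linear_combination -e1.2.2.1 / 3)
    apply mat2_eq_zero <;> grind
  have hY : A 2 0 0 = 0 ∧ A 2 1 0 = 0 ∧ A 2 1 1 = 0 := by
    have h1 := cancel (A 2 0 0 - 2 * x₂) (by linear_combination -e2.1)
    have h2 := cancel (A 2 1 1 - x₂) (by linear_combination -e2.2.2.2)
    have h3 := cancel (A 2 1 0) (by linear_combination -e2.2.2.1 / 2)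
    grind
  have B01 := cancel (A 3 0 1) (by linear_combination e3.2.1)
  have B10 := cancel (A 3 1 0) (by linear_combination -e3.2.2.1)
  simp only [hX, hY, B01, B10, Matrix.zero_apply] at e4 e5 e6
  have F10 := cancel (A 4 1 0) (by linear_combination e4.2.2.1 / 2)
  have P10 := cancel (A 5 1 0) (by linear_combination e5.2.2.1)
  have Q01 := cancel (A 6 0 1) (by linear_combination e6.2.1 / 2)
  have hab : A 2 0 1 = 0 ∨ A 6 1 0 = 0 := by
    obtain ⟨W, W', V, V', f1, f2, f3, f4, g⟩ := h.mixed
    have h' := g.2.1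
    rw [mat2_ext_iff] at f1 f2 f3 f4 h'
    simp only [Matrix.mul_apply, Fin.sum_univ_two, Matrix.sub_apply, Matrix.add_apply,
      Matrix.smul_apply, smul_eq_mul, hX, hY, h0', P10, Q01, Matrix.zero_apply] at f1 f2 f3 f4 h'
    grind
  rcases hab with h2 | h6
  · right
    rw [h2] at e4 e5
    have F01 := cancel (A 4 0 1) (by linear_combination e4.2.1 / 4)
    have P01 := cancel (A 5 0 1) (by linear_combination e5.2.1 / 3)
    intro i
    fin_cases i <;> simp [h0', hX, h2, B01, F01, P01, Q01]
  · left
    intro i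
    fin_cases i <;> simp [h0', hX, hY, B10, F10, P10, h6]

/-- The case where `S` is not semisimple and invertible. -/
lemma AdEqs.upper_of_jordan {X Y B F P Q : M2}
    (hS : AdEqs S X Y B F P Q m r s w b x₁ x₂ x₄ x₅ x₆)
    (s01 : S 0 1 ≠ 0) (s10 : S 1 0 = 0) (s11 : S 1 1 ≠ 0) (s00 : S 0 0 = S 1 1) :
    X 1 0 = 0 ∧ Y 1 0 = 0 ∧ B 1 0 = 0 ∧ F 1 0 = 0 ∧ P 1 0 = 0 ∧ Q 1 0 = 0 := by
  obtain ⟨e1, e2, e3, e4, e5, e6⟩ := hS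
  rw [mat2_ext_iff] at e1 e2 e3 e4 e5 e6
  simp only [s10, s00, Matrix.mul_apply, Fin.sum_univ_two, Matrix.sub_apply, Matrix.add_apply,
    Matrix.smul_apply, Matrix.neg_apply, smul_eq_mul] at e1 e2 e3 e4 e5 e6
  have X10 : X 1 0 = 0 := by grind
  have X00 : X 0 0 = X 1 1 := by grind
  have Y10 : Y 1 0 = 0 := by grind
  have Y00 : Y 0 0 = Y 1 1 := by grind
  have B10 : B 1 0 = 0 := by grind
  have B00 : B 0 0 = B 1 1 := by grind
  have Q10 : Q 1 0 = 0 := by grind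
  have P10 : P 1 0 = 0 := by grind
  have F10 : F 1 0 = 0 := by grind
  exact ⟨X10, Y10, B10, F10, P10, Q10⟩

/-- The case where `A 0` is nilpotent and nonzero. -/
lemma GConn.upper_of_nilpotent_zero (h : GConn A v y)
    (s00 : A 0 0 0 = 0) (s01 : A 0 0 1 ≠ 0) (s10 : A 0 1 0 = 0) (s11 : A 0 1 1 = 0) (i : Fin 7) :
    A i 1 0 = 0 := by
  have v0 : v 0 = 0 := by
    have := h.v03
    simp [s00, s11] at this
    exact this
  have e1 := h.z1
  have e2 := h.z2
  have e3 := h.z3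
  have e4 := h.z4
  have e5 := h.z5
  have e6 := h.z6
  have hy := h.y06
  rw [mat2_ext_iff] at e1 e2 e3 e4 e5 e6
  simp only [s10, s00, s11, v0, Matrix.mul_apply, Fin.sum_univ_two, Matrix.sub_apply,
    Matrix.add_apply, Matrix.smul_apply, Matrix.neg_apply, smul_eq_mul] at e1 e2 e3 e4 e5 e6 hy
  have X10 : A 1 1 0 = 0 := by grind
  have Y10 : A 2 1 0 = 0 := by grind
  have X00 : A 1 0 0 = 0 := by grind
  have B10 : A 3 1 0 = 0 := by grind
  have Q10 : A 6 1 0 = 0 := by grind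
  have Q00 : A 6 0 0 + A 6 1 1 = 0 := by grind
  have P10 : A 5 1 0 = 0 := by grind
  have F10 : A 4 1 0 = 0 := by grind
  fin_cases i <;> simp [*]

/-- The case where `A 0` vanishes and `A 3` is nilpotent and nonzero. -/
lemma GConn.upper_of_nilpotent_three (h : GConn A v y) (h0 : A 0 = 0)
    (s00 : A 3 0 0 = 0) (s01 : A 3 0 1 ≠ 0) (s10 : A 3 1 0 = 0) (s11 : A 3 1 1 = 0) (i : Fin 7) :
    A i 1 0 = 0 := by
  have v0 : v 0 = 0 := by
    have := h.v03
    simp [h0] at this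
    exact this
  have e1 := h.t1
  have e2 := h.t2
  have e4 := h.t4
  have e5 := h.t5
  have e6 := h.t6
  have hf := h.flat
  have hv := h.v12
  have hv' := h.v23
  rw [mat2_ext_iff] at e1 e2 e4 e5 e6 hf
  simp only [s10, s00, s11, v0, h0, Matrix.mul_apply, Fin.sum_univ_two, Matrix.sub_apply,
    Matrix.add_apply, Matrix.smul_apply, Matrix.neg_apply, Matrix.zero_apply, smul_eq_mul]
    at e1 e2 e4 e5 e6 hf hv hv'
  have X10 : A 1 1 0 = 0 := by grind
  have X00 : A 1 0 0 = 0 := by grind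
  have X11 : A 1 1 1 = 0 := by grind
  have Y10 : A 2 1 0 = 0 := by grind
  have Y11 : A 2 1 1 = A 2 0 0 + A 1 0 1 := by grind
  have Q10 : A 6 1 0 = 0 := by grind
  have hx : A 1 0 1 = 0 ∨ A 2 0 0 = 0 ∧ v 3 = 0 := by grind
  have P10 : A 5 1 0 = 0 := by grind
  have F10 : A 4 1 0 = 0 := by grind
  fin_cases i <;> simp [*]
end

/-- The `𝔤𝔩(2)`-parts of the values of `L` lie in a subspace which is closed under commutators
and does not contain `𝔰𝔩(2)`. -/
def IsReducible (L : V7 →ₗ[ℝ] M7) : Prop :=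
  ∃ U : Submodule ℝ M2, (∀ P ∈ U, ∀ Q ∈ U, P * Q - Q * P ∈ U) ∧ (∀ x, proA (L x) ∈ U) ∧
    ∃ N, N 0 0 + N 1 1 = 0 ∧ N ∉ U

lemma proA_mem_of_forall_e {L : V7 →ₗ[ℝ] M7} (U : Submodule ℝ M2)
    (h : ∀ i, proA (L (e i)) ∈ U) (x : V7) : proA (L x) ∈ U := by
  rw [linear_eq_sum, proA_sum]
  refine U.sum_mem fun i _ => ?_
  rw [proA_smul]
  exact U.smul_mem _ (h i)

/-- The centralizer of `Z` as a subspace. -/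
def centralizer2 (Z : M2) : Submodule ℝ M2 :=
  LinearMap.ker (LinearMap.mulLeft ℝ Z - LinearMap.mulRight ℝ Z)

lemma mem_centralizer2 {Z P : M2} : P ∈ centralizer2 Z ↔ Z * P = P * Z := by
  simp [centralizer2, sub_eq_zero]

lemma IsReducible.of_commute {L : V7 →ₗ[ℝ] M7} {Z : M2} (hZ : IsNonScalar Z)
    (h : ∀ i, Z * proA (L (e i)) = proA (L (e i)) * Z) : IsReducible L := by
  refine ⟨centralizer2 Z, ?_, proA_mem_of_forall_e _ fun i => mem_centralizer2.mpr (h i), ?_⟩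
  · intro P hP Q hQ
    rw [mem_centralizer2] at hP hQ ⊢
    rw [mul_sub, sub_mul, ← mul_assoc, hP, mul_assoc, hQ, ← mul_assoc, ← mul_assoc, hQ, mul_assoc Q,
      hP, ← mul_assoc]
  · by_contra! hN
    have h1 := hN !![0, 1; 0, 0] (by simp)
    have h2 := hN !![0, 0; 1, 0] (by simp)
    rw [mem_centralizer2, mat2_ext_iff] at h1 h2
    simp [Matrix.mul_apply, Fin.sum_univ_two] at h1 h2
    unfold IsNonScalar at hZ
    grind

/-- The subspace of matrices with vanishing `(i, j)`-entry. -/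
def zeroEntry (i j : Fin 2) : Submodule ℝ M2 where
  carrier := {P | P i j = 0}
  add_mem' {P Q} hP hQ := by simp_all
  zero_mem' := by simp
  smul_mem' c P hP := by simp_all

lemma IsReducible.of_entry {L : V7 →ₗ[ℝ] M7} {i j : Fin 2} (hij : i ≠ j)
    (h : ∀ k, proA (L (e k)) i j = 0) : IsReducible L := by
  refine ⟨zeroEntry i j, ?_, proA_mem_of_forall_e _ h, Matrix.single i j 1, ?_, ?_⟩
  · intro P (hP : P i j = 0) Q (hQ : Q i j = 0)
    change (P * Q - Q * P) i j = 0
    fin_cases i <;> fin_cases j <;>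
      simp_all [Matrix.mul_apply, Fin.sum_univ_two]
  · fin_cases i <;> fin_cases j <;> simp_all
  · intro (hN : Matrix.single i j (1 : ℝ) i j = 0)
    simp at hN

section
variable {A : Fin 7 → M2} {v : Fin 7 → ℝ} {y : Fin 7 → Fin 2 → ℝ}

lemma GConn.adEqs_zero (h : GConn A v y) :
    AdEqs (A 0) (A 1) (A 2) (A 3) (A 4) (A 5) (A 6) (v 0) (y 0 0) (y 0 1) (√2 * v 0)
      (√2 * v 0 - (A 3 0 0 + A 3 1 1)) (A 1 0 0 + A 1 1 1) (A 2 0 0 + A 2 1 1)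
      (A 4 0 0 + A 4 1 1) (y 0 0 + (A 5 0 0 + A 5 1 1)) (y 0 1 + (A 6 0 0 + A 6 1 1)) :=
  ⟨h.z1, h.z2, h.z3, h.z4, h.z5, h.z6⟩

lemma GConn.adEqs_three (h : GConn A v y) (h0 : A 0 = 0) :
    AdEqs (A 3) (A 1) (A 2) (A 3) (A 4) (A 5) (A 6) (v 3) (y 3 0) (y 3 1) (√2 * v 3)
      0 0 0 0 0 0 := by
  constructor
  · simpa [h0] using h.t1
  · simpa [h0] using h.t2
  · simp
  · simpa [h0] using h.t4
  · simpa [h0] using h.t5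
  · simpa [h0] using h.t6

end

/-- The normal forms of nonzero real `2 × 2` matrices used in the case distinction. -/
def IsNormalForm (S : M2) : Prop :=
  (∃ c : ℝ, c ≠ 0 ∧ S = c • 1) ∨
  ((S 0 0 + S 1 1) ^ 2 - 4 * (S 0 0 * S 1 1 - S 0 1 * S 1 0) ≠ 0 ∧
    S 0 0 * S 1 1 - S 0 1 * S 1 0 ≠ 0 ∧
    9 * (S 0 0 * S 1 1 - S 0 1 * S 1 0) - 2 * (S 0 0 + S 1 1) ^ 2 ≠ 0) ∨
  (S 0 0 ≠ 0 ∧ S 0 1 = 0 ∧ S 1 0 = 0 ∧ S 1 1 = 0) ∨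
  (S 0 1 = 0 ∧ S 1 0 = 0 ∧ S 1 1 ≠ 0 ∧ S 0 0 = 2 * S 1 1) ∨
  (S 0 1 ≠ 0 ∧ S 1 0 = 0 ∧ S 0 0 = S 1 1)

lemma GConn.triangular_or_commute {A : Fin 7 → M2} {v : Fin 7 → ℝ} {y : Fin 7 → Fin 2 → ℝ} {S : M2}
    {θ m r s w b x₁ x₂ x₄ x₅ x₆ : ℝ} (h : GConn A v y)
    (hS : AdEqs S (A 1) (A 2) (A 3) (A 4) (A 5) (A 6) m r s w b x₁ x₂ x₄ x₅ x₆)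
    (h0 : A 0 = θ • S) (hx₁ : x₁ = θ * (A 1 0 0 + A 1 1 1)) (hx₂ : x₂ = θ * (A 2 0 0 + A 2 1 1))
    (hθ : θ = 0 ∧ S = A 3 ∨ θ = 1) (hN : IsNormalForm S) :
    (∃ Z, IsNonScalar Z ∧ ∀ i, Z * A i = A i * Z) ∨ (∀ i, A i 1 0 = 0) ∨ (∀ i, A i 0 1 = 0) := by
  rcases hN with ⟨c, hc, hSc⟩ | ⟨hD, hδ, h9⟩ | ⟨s00, s01, s10, s11⟩ | ⟨s01, s10, s11, s00⟩ |
    ⟨s01, s10, s00⟩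
  · left
    obtain ⟨Z, hZ, hc0, hc1, hc2, hc3, hc4, hc5, hc6⟩ := hS.commute_of_scalar hc hSc
    refine ⟨Z, hZ, fun i => ?_⟩
    fin_cases i <;> simp [*]
  · left
    obtain ⟨hc1, hc2, hc3, hc4, hc5, hc6⟩ := hS.commute_of_generic hD hδ h9
    refine ⟨S, ?_, fun i => ?_⟩
    · by_contra hs
      simp only [IsNonScalar, not_or, not_not] at hs
      obtain ⟨h01, h10, h00⟩ := hs
      exact hD (by rw [h01, h10, h00]; ring)
    · fin_cases i <;> simp [*]
  · right
    exact h.triangular_of_rank_one hS h0 hx₁ hx₂ s00 s01 s10 s11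
  · right
    exact h.triangular_of_resonant hS h0 hx₁ hx₂ (hθ.imp_left And.left) s01 s10 s11 s00
  · right
    left
    by_cases s11 : S 1 1 = 0
    · rcases hθ with ⟨hθ, hS3⟩ | hθ
      · subst hS3
        exact h.upper_of_nilpotent_three (by simp [h0, hθ]) (s00.trans s11) s01 s10 s11
      · obtain rfl : A 0 = S := by simp [h0, hθ]
        exact h.upper_of_nilpotent_zero (s00.trans s11) s01 s10 s11
    · obtain ⟨h1, h2, h3, h4, h5, h6⟩ := hS.upper_of_jordan s01 s10 s11 s00
      intro i
      fin_cases i <;> simp [*]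

lemma CurvIII.isReducible_of_isNormalForm {L : V7 →ₗ[ℝ] M7} (h : CurvIII L)
    (hL : ∀ x, L x ∈ hIII) (hN : IsNormalForm (proA (L (e 0))) ∨
      proA (L (e 0)) = 0 ∧ IsNormalForm (proA (L (e 3)))) : IsReducible L := by
  choose A v y hA using fun i => hL (e i)
  have hP : ∀ i, proA (L (e i)) = A i := fun i => by rw [hA, proA_h3]
  have hG := h.gConn hA
  rw [hP, hP] at hN
  have key : (∃ Z, IsNonScalar Z ∧ ∀ i, Z * A i = A i * Z) ∨ (∀ i, A i 1 0 = 0) ∨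
      (∀ i, A i 0 1 = 0) := by
    rcases hN with hN | ⟨h0, hN⟩
    · exact hG.triangular_or_commute hG.adEqs_zero (θ := 1) (by simp) (by simp) (by simp)
        (Or.inr rfl) hN
    · exact hG.triangular_or_commute (hG.adEqs_three h0) (θ := 0) (by simp [h0]) (by simp)
        (by simp) (Or.inl ⟨rfl, rfl⟩) hN
  simp only [← hP] at key
  rcases key with ⟨Z, hZ, hc⟩ | hc | hc
  · exact .of_commute hZ hc
  · exact .of_entry one_ne_zero hc
  · exact .of_entry zero_ne_one hc

/-- The block diagonal matrix `diag(1, g, 1, 1, g⁻ᵀ)` for a matrix `g` of determinant `1`. -/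
def block7 (g : M2) : M7 :=
  !![1, 0, 0, 0, 0, 0, 0;
     0, g 0 0, g 0 1, 0, 0, 0, 0;
     0, g 1 0, g 1 1, 0, 0, 0, 0;
     0, 0, 0, 1, 0, 0, 0;
     0, 0, 0, 0, 1, 0, 0;
     0, 0, 0, 0, 0, g 1 1, -g 1 0;
     0, 0, 0, 0, 0, -g 0 1, g 0 0]

lemma block7_mul_block7 (g k : M2) : block7 g * block7 k = block7 (g * k) := by
  ext i j
  fin_cases i <;> fin_cases j <;>
    simp [block7, Matrix.mul_apply, Fin.sum_univ_succ] <;> ring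

lemma block7_one : block7 1 = 1 := by
  ext i j
  fin_cases i <;> fin_cases j <;> simp [block7]

lemma block7_mul_h3 {g A B : M2} (hd : g.det = 1) (h : g * A = B * g)
    (h' : A * g.adjugate = g.adjugate * B) (ht : A.trace = B.trace) (v : ℝ) (y : Fin 2 → ℝ) :
    block7 g * h3 A v y = h3 B v (g *ᵥ y) * block7 g := by
  rw [mat2_ext_iff] at h h'
  rw [Matrix.adjugate_fin_two] at h'
  rw [Matrix.det_fin_two] at hd
  simp only [Matrix.trace_fin_two] at ht
  obtain ⟨a1, a2, a3, a4⟩ := h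
  obtain ⟨b1, b2, b3, b4⟩ := h'
  simp [Matrix.mul_apply, Fin.sum_univ_two] at a1 a2 a3 a4 b1 b2 b3 b4
  ext i j
  fin_cases i <;> fin_cases j <;>
    simp [block7, h3, hmat, Matrix.mul_apply, Fin.sum_univ_succ, Matrix.mulVec, dotProduct] <;>
    first
    | ring1
    | linarith
    | linear_combination v * hd
    | linear_combination -v * hd
    | linear_combination y 0 * hd
    | linear_combination y 1 * hd

lemma block7_conj {g k : M2} (hg : g * k = 1) (hd : g.det = 1) (A : M2) (v : ℝ) (y : Fin 2 → ℝ) :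
    block7 g * h3 A v y * block7 k = h3 (g * A * k) v (g *ᵥ y) := by
  have hg' := mul_eq_one_comm.mp hg
  have hk : g.adjugate = k := by
    rw [← Matrix.inv_eq_right_inv hg, Matrix.inv_def, hd]
    simp
  rw [block7_mul_h3 (B := g * A * k) hd, mul_assoc, block7_mul_block7, hg, block7_one, mul_one]
  · simp only [mul_assoc, hg', mul_one]
  · simp only [hk, ← mul_assoc, hg', one_mul]
  · rw [Matrix.trace_mul_comm, ← mul_assoc, hg', one_mul]

/-- The conjugate of a connection by `block7 g`, where `k` is the inverse of `g`. -/
def conj7 (g k : M2) (L : V7 →ₗ[ℝ] M7) : V7 →ₗ[ℝ] M7 :=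
  LinearMap.mulRight ℝ (block7 k) ∘ₗ LinearMap.mulLeft ℝ (block7 g) ∘ₗ L ∘ₗ (block7 k).mulVecLin

lemma conj7_apply (g k : M2) (L : V7 →ₗ[ℝ] M7) (x : V7) :
    conj7 g k L x = block7 g * L (block7 k *ᵥ x) * block7 k := by
  simp [conj7]

lemma cv_conj7 {g k : M2} (hg : g * k = 1) (L : V7 →ₗ[ℝ] M7) (x y : V7) :
    cv (conj7 g k L) x y = block7 g * cv L (block7 k *ᵥ x) (block7 k *ᵥ y) * block7 k := by
  have hk : block7 k * block7 g = 1 := by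
    rw [block7_mul_block7, mul_eq_one_comm.mp hg, block7_one]
  have key : ∀ X Y : M7, block7 g * X * block7 k * (block7 g * Y * block7 k)
      = block7 g * (X * Y) * block7 k := fun X Y => by
    simp only [mul_assoc]
    rw [← mul_assoc (block7 k) (block7 g), hk, one_mul]
  simp only [cv, conj7_apply, key, mul_sub, sub_mul, Matrix.mulVec_mulVec,
    ← mul_assoc, hk, one_mul, map_sub]

lemma CurvIII.curvIII_conj7 {L : V7 →ₗ[ℝ] M7} (h : CurvIII L) {g k : M2} (hg : g * k = 1)
    (hd : g.det = 1) : CurvIII (conj7 g k L) := by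
  constructor
  · intro x y
    obtain ⟨A, v, z, hA⟩ := h.mem (block7 k *ᵥ x) (block7 k *ᵥ y)
    exact ⟨_, _, _, by rw [cv_conj7 hg, hA, block7_conj hg hd]⟩
  · intro x y z
    have := congrArg (block7 g *ᵥ ·) (h.bianchi (block7 k *ᵥ x) (block7 k *ᵥ y) (block7 k *ᵥ z))
    simpa only [cv_conj7 hg, Matrix.mulVec_add, Matrix.mulVec_mulVec, Matrix.mulVec_zero, mul_assoc]
      using this

lemma IsReducible.of_conj7 {L : V7 →ₗ[ℝ] M7} (hL : ∀ x, L x ∈ hIII) {g k : M2} (hg : g * k = 1)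
    (hd : g.det = 1) (h : IsReducible (conj7 g k L)) : IsReducible L := by
  have hg' := mul_eq_one_comm.mp hg
  obtain ⟨U, hU, hmem, N, hN, hNU⟩ := h
  refine ⟨U.comap (LinearMap.mulRight ℝ k ∘ₗ LinearMap.mulLeft ℝ g), ?_, ?_, k * N * g, ?_, ?_⟩
  · intro P hP Q hQ
    simp only [Submodule.mem_comap, LinearMap.comp_apply, LinearMap.mulLeft_apply,
      LinearMap.mulRight_apply] at hP hQ ⊢
    have := hU _ hP _ hQ
    have key : ∀ X Y : M2, g * X * k * (g * Y * k) = g * (X * Y) * k := fun X Y => by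
      simp only [mul_assoc]
      rw [← mul_assoc k g, hg', one_mul]
    rwa [key, key, ← sub_mul, ← mul_sub] at this
  · intro x
    have := hmem (block7 g *ᵥ x)
    obtain ⟨A, v, y, hA⟩ := hL x
    rw [conj7_apply, Matrix.mulVec_mulVec, block7_mul_block7, hg', block7_one, Matrix.one_mulVec,
      hA, block7_conj hg hd, proA_h3] at this
    simpa [hA, proA_h3] using this
  · have : (k * N * g).trace = N.trace := by rw [Matrix.trace_mul_comm, ← mul_assoc, hg, one_mul]
    rwa [Matrix.trace_fin_two, Matrix.trace_fin_two, hN] at this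
  · simp only [Submodule.mem_comap, LinearMap.comp_apply, LinearMap.mulLeft_apply,
      LinearMap.mulRight_apply]
    rwa [← mul_assoc, ← mul_assoc, hg, one_mul, mul_assoc, hg, mul_one]

/-- A real `2 × 2` matrix with a real eigenvalue is triangularizable by a matrix of
determinant `1`. -/
lemma exists_conj_upper (S : M2) {a b : ℝ} (ht : S.trace = a + b) (hd : S.det = a * b) :
    ∃ g k : M2, g * k = 1 ∧ g.det = 1 ∧ ∃ n, g * S * k = !![a, n; 0, b] := by
  have h0 : (S - a • (1 : M2)).det = 0 := by
    rw [Matrix.det_fin_two, Matrix.trace_fin_two] at *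
    simp
    linear_combination hd - a * ht
  obtain ⟨w, hw, hSw⟩ := Matrix.exists_mulVec_eq_zero_iff.mpr h0
  have h1 := congrFun hSw 0
  have h2 := congrFun hSw 1
  simp [Matrix.mulVec, dotProduct] at h1 h2
  have hr : w 0 ^ 2 + w 1 ^ 2 ≠ 0 := fun h => hw <| by
    ext i
    fin_cases i <;> simp <;> nlinarith [sq_nonneg (w 0), sq_nonneg (w 1)]
  set r := w 0 ^ 2 + w 1 ^ 2 with hrdef
  refine ⟨!![w 0 / r, w 1 / r; -w 1, w 0], !![w 0, -w 1 / r; w 1, w 0 / r], ?_, ?_, ?_⟩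
  · ext i j
    fin_cases i <;> fin_cases j <;> simp [Matrix.mul_apply, Fin.sum_univ_two] <;> field_simp <;>
      ring1
  · simp [Matrix.det_fin_two]
    field_simp
    rw [hrdef]
  · rw [Matrix.trace_fin_two] at ht
    refine ⟨_, mat2_ext_iff.mpr ⟨?_, rfl, ?_, ?_⟩⟩
    · simp [Matrix.mul_apply, Fin.sum_univ_two, Matrix.vecMul, dotProduct]
      field_simp
      rw [hrdef]
      linear_combination w 0 * h1 + w 1 * h2
    · simp [Matrix.mul_apply, Fin.sum_univ_two, Matrix.vecMul, dotProduct]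
      linear_combination w 0 * h2 - w 1 * h1
    · simp [Matrix.mul_apply, Fin.sum_univ_two, Matrix.vecMul, dotProduct]
      field_simp
      rw [hrdef]
      linear_combination (w 0 ^ 2 + w 1 ^ 2) * ht - w 0 * h1 - w 1 * h2

lemma exists_conj_diagonal (S : M2) {a b : ℝ} (hab : a ≠ b) (ht : S.trace = a + b)
    (hd : S.det = a * b) :
    ∃ g k : M2, g * k = 1 ∧ g.det = 1 ∧ g * S * k = !![a, 0; 0, b] := by
  obtain ⟨g, k, hg, hdet, n, hn⟩ := exists_conj_upper S ht hd
  have hab' := sub_ne_zero.mpr hab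
  refine ⟨!![1, n / (a - b); 0, 1] * g, k * !![1, -(n / (a - b)); 0, 1], ?_, ?_, ?_⟩
  · rw [mul_assoc, ← mul_assoc g, hg, one_mul]
    ext i j
    fin_cases i <;> fin_cases j <;> simp [Matrix.mul_apply, Fin.sum_univ_two]
  · rw [Matrix.det_mul, hdet]
    simp [Matrix.det_fin_two]
  · have : !![1, n / (a - b); 0, 1] * g * S * (k * !![1, -(n / (a - b)); 0, 1])
        = !![1, n / (a - b); 0, 1] * (g * S * k) * !![1, -(n / (a - b)); 0, 1] := by
      simp only [mul_assoc]
    rw [this, hn]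
    ext i j
    fin_cases i <;> fin_cases j <;> simp [Matrix.mul_apply, Fin.sum_univ_two]
    field_simp
    ring

lemma exists_conj_isNormalForm {S : M2} (hS : S ≠ 0) :
    ∃ g k : M2, g * k = 1 ∧ g.det = 1 ∧ IsNormalForm (g * S * k) := by
  by_cases hs : ∃ c : ℝ, S = c • 1
  · obtain ⟨c, hc⟩ := hs
    refine ⟨1, 1, by simp, by simp, Or.inl ⟨c, ?_, by simpa using hc⟩⟩
    rintro rfl
    exact hS (by simpa using hc)
  by_cases hD : S.trace ^ 2 - 4 * S.det = 0
  · obtain ⟨g, k, hg, hd, n, hn⟩ := exists_conj_upper S (a := S.trace / 2) (b := S.trace / 2)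
      (by ring) (by linear_combination -hD / 4)
    refine ⟨g, k, hg, hd, ?_⟩
    rw [hn]
    refine Or.inr (Or.inr (Or.inr (Or.inr ⟨?_, by simp, by simp⟩)))
    intro h0
    have h0' : n = 0 := by simpa using h0
    refine hs ⟨S.trace / 2, ?_⟩
    have hg' := mul_eq_one_comm.mp hg
    have : k * (g * S * k) * g = S := by
      rw [← mul_assoc, ← mul_assoc, hg', one_mul, mul_assoc, hg', mul_one]
    have hc : g * S * k = (S.trace / 2) • 1 := by
      rw [hn, h0', mat2_ext_iff]
      simp
    rw [← this, hc]
    simp [hg']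
  by_cases hδ : S.det = 0
  · obtain ⟨g, k, hg, hd, hn⟩ := exists_conj_diagonal S (a := S.trace) (b := 0)
      (fun h => hD (by rw [h, hδ]; ring)) (by ring) (by rw [hδ]; ring)
    refine ⟨g, k, hg, hd, ?_⟩
    rw [hn]
    refine Or.inr (Or.inr (Or.inl ?_))
    simp
    intro h
    exact hD (by rw [h, hδ]; ring)
  by_cases h9 : 9 * S.det - 2 * S.trace ^ 2 = 0
  · have ht : S.trace ≠ 0 := fun h => hδ (by linear_combination (h9 + 2 * S.trace * h) / 9)
    obtain ⟨g, k, hg, hd, hn⟩ := exists_conj_diagonal S (a := 2 * S.trace / 3) (b := S.trace / 3)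
      (fun h => ht (by linear_combination 3 * h)) (by ring) (by linear_combination h9 / 9)
    refine ⟨g, k, hg, hd, ?_⟩
    rw [hn]
    refine Or.inr (Or.inr (Or.inr (Or.inl ?_)))
    simp [ht]
    ring
  · refine ⟨1, 1, by simp, by simp, Or.inr (Or.inl ?_)⟩
    rw [Matrix.det_fin_two, Matrix.trace_fin_two] at *
    simpa using ⟨hD, hδ, h9⟩

lemma block7_mulVec_e_zero (g : M2) : block7 g *ᵥ e 0 = e 0 := by
  ext i
  rw [mulVec_e]
  fin_cases i <;> simp [block7, e]

lemma block7_mulVec_e_three (g : M2) : block7 g *ᵥ e 3 = e 3 := by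
  ext i
  rw [mulVec_e]
  fin_cases i <;> simp [block7, e]

/-- If the `𝔤𝔩(2)`-part of the value at `e 0` or at `e 3` does not vanish, then the connection
is reducible. -/
lemma CurvIII.isReducible {L : V7 →ₗ[ℝ] M7} (h : CurvIII L) (hL : ∀ x, L x ∈ hIII)
    (hA : proA (L (e 0)) ≠ 0 ∨ proA (L (e 3)) ≠ 0) : IsReducible L := by
  have hmem : ∀ g k : M2, g * k = 1 → g.det = 1 → ∀ x, conj7 g k L x ∈ hIII := by
    intro g k hg hd x
    obtain ⟨A, v, y, hA⟩ := hL (block7 k *ᵥ x)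
    exact ⟨_, _, _, by rw [conj7_apply, hA, block7_conj hg hd]⟩
  have hconj : ∀ g k : M2, g * k = 1 → g.det = 1 → ∀ x, block7 k *ᵥ x = x →
      proA (conj7 g k L x) = g * proA (L x) * k := by
    intro g k hg hd x hx
    obtain ⟨A, v, y, hA⟩ := hL x
    rw [conj7_apply, hx, hA, block7_conj hg hd, proA_h3, proA_h3]
  by_cases h0 : proA (L (e 0)) = 0
  · obtain ⟨g, k, hg, hd, hN⟩ := exists_conj_isNormalForm (hA.resolve_left (not_not.mpr h0))
    refine .of_conj7 hL hg hd ((h.curvIII_conj7 hg hd).isReducible_of_isNormalForm (hmem g k hg hd)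
      (Or.inr ⟨?_, ?_⟩))
    · rw [hconj g k hg hd _ (block7_mulVec_e_zero k), h0]
      simp
    · rwa [hconj g k hg hd _ (block7_mulVec_e_three k)]
  · obtain ⟨g, k, hg, hd, hN⟩ := exists_conj_isNormalForm h0
    refine .of_conj7 hL hg hd ((h.curvIII_conj7 hg hd).isReducible_of_isNormalForm (hmem g k hg hd)
      (Or.inl ?_))
    rwa [hconj g k hg hd _ (block7_mulVec_e_zero k)]

section
variable {L : V7 →ₗ[ℝ] M7} {bk : V7 → V7 → V7}

lemma curv_eq_cv (hbk : ∀ x y : V7, L x *ᵥ y - L y *ᵥ x = bk x y) (x y : V7) :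
    curv L bk x y = cv L x y := by
  rw [curv, cv, hbk]

lemma curv_mem_infHol (x y : V7) : curv L bk x y ∈ infHol L bk := by
  rw [infHol, Submodule.mem_sInf]
  exact fun H hH => hH.1 x y

lemma commutator_mem_infHol (z : V7) {X : M7} (hX : X ∈ infHol L bk) :
    L z * X - X * L z ∈ infHol L bk := by
  rw [infHol, Submodule.mem_sInf] at *
  exact fun H hH => hH.2 z X (hX H hH)

lemma infHol_le (U : Submodule ℝ M7) (hc : ∀ x y, curv L bk x y ∈ U)
    (hU : ∀ z, ∀ X ∈ infHol L bk, X ∈ U → L z * X - X * L z ∈ U) : infHol L bk ≤ U := by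
  have : infHol L bk ≤ infHol L bk ⊓ U := by
    refine sInf_le ⟨fun x y => ⟨curv_mem_infHol x y, hc x y⟩, fun z X hX => ?_⟩
    exact ⟨commutator_mem_infHol z hX.1, hU z X hX.1 hX.2⟩
  exact this.trans inf_le_right

end

/-- `proA` as a linear map. -/
def proALin : M7 →ₗ[ℝ] M2 where
  toFun := proA
  map_add' := proA_add
  map_smul' := proA_smul

lemma proA_h3_commutator {X Y : M7} (hX : X ∈ hIII) (hY : Y ∈ hIII) :
    proA (X * Y - Y * X) = proA X * proA Y - proA Y * proA X := by
  obtain ⟨A, v, y, rfl⟩ := hX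
  obtain ⟨B, w, z, rfl⟩ := hY
  rw [proA_sub, h3, h3, proA_hmat_mul, proA_hmat_mul, proA_hmat, proA_hmat]

lemma proA_mem_of_mem_infHol {L : V7 →ₗ[ℝ] M7} {bk : V7 → V7 → V7} (hL : ∀ x, L x ∈ hIII)
    (hhol : ∀ X ∈ infHol L bk, X ∈ hIII) {U : Submodule ℝ M2}
    (hU : ∀ P ∈ U, ∀ Q ∈ U, P * Q - Q * P ∈ U) (hLU : ∀ x, proA (L x) ∈ U) {X : M7}
    (hX : X ∈ infHol L bk) : proA X ∈ U := by
  refine infHol_le (U.comap proALin) (fun x y => ?_) (fun z X hX hXU => ?_) hX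
  · change proA _ ∈ U
    have h : proA (L x * L y - L y * L x) ∈ U := by
      rw [proA_h3_commutator (hL x) (hL y)]
      exact hU _ (hLU x) _ (hLU y)
    rw [curv, proA_sub]
    exact U.sub_mem h (hLU _)
  · change proA _ ∈ U
    rw [proA_h3_commutator (hL z) (hhol X hX)]
    exact hU _ (hLU z) _ hXU

lemma curvIII_of_infHol {L : V7 →ₗ[ℝ] M7} {bk : V7 → V7 → V7}
    (hbk : ∀ x y : V7, L x *ᵥ y - L y *ᵥ x = bk x y)
    (hjac : ∀ x y z : V7, bk (bk x y) z + bk (bk y z) x + bk (bk z x) y = 0)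
    (hhol : ∀ X ∈ infHol L bk, X ∈ hIII) : CurvIII L :=
  ⟨fun x y => curv_eq_cv hbk x y ▸ hhol _ (curv_mem_infHol x y), bianchi_of_jacobi hbk hjac⟩

/-- The normalizer conditions for `h(0, 1, 0)`. -/
lemma Xg2_of_commutator_vee {s : Fin 14 → ℝ}
    (h : Xg2 s * h3 0 1 0 - h3 0 1 0 * Xg2 s ∈ hIII) :
    s 6 = 0 ∧ s 7 = 0 ∧ s 12 = 0 ∧ s 13 = 0 ∧
      proA (Xg2 s * h3 0 1 0 - h3 0 1 0 * Xg2 s) = (-s 4) • 1 := by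
  have hX : proA (Xg2 s * h3 0 1 0 - h3 0 1 0 * Xg2 s) = (-s 4) • 1 := by
    ext i j
    fin_cases i <;> fin_cases j <;>
      simp [proA, Xg2, h3, hmat]
  obtain ⟨A, v, y, hA⟩ := h
  have h10 := congrFun (congrFun hA 1) 0
  have h20 := congrFun (congrFun hA 2) 0
  have h13 := congrFun (congrFun hA 1) 3
  have h23 := congrFun (congrFun hA 2) 3
  simp [Xg2, h3, hmat] at h10 h20 h13 h23
  have h2 : (√2 : ℝ) ≠ 0 := by positivity
  refine ⟨?_, ?_, h20, h10, hX⟩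
  · have : √2 * s 6 = 0 := by linear_combination h23 / 2
    exact (mul_eq_zero.mp this).resolve_left h2
  · have : √2 * s 7 = 0 := by linear_combination -h13 / 2
    exact (mul_eq_zero.mp this).resolve_left h2

/-- The normalizer conditions for `h(A, 0, 0)`. -/
lemma Xg2_of_commutator_gl {s : Fin 14 → ℝ} {A : M2}
    (h : Xg2 s * h3 A 0 0 - h3 A 0 0 * Xg2 s ∈ hIII) :
    s 4 * A.trace = 0 ∧ A 0 0 * s 8 + A 0 1 * s 9 = 0 ∧ A 1 0 * s 8 + A 1 1 * s 9 = 0 := by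
  obtain ⟨B, v, y, hB⟩ := h
  have h30 := congrFun (congrFun hB 3) 0
  have h13 := congrFun (congrFun hB 1) 3
  have h23 := congrFun (congrFun hB 2) 3
  simp [Xg2, h3, hmat] at h30 h13 h23
  have h2 : (√2 : ℝ) ≠ 0 := by positivity
  rw [Matrix.trace_fin_two]
  refine ⟨mul_left_cancel₀ h2 ?_, mul_left_cancel₀ h2 ?_, mul_left_cancel₀ h2 ?_⟩
  · rcases h30 with h | h
    · simp [h]
    · simp [h]
  · linear_combination -h13
  · linear_combination -h23

lemma Xg2_eq_hmat {s : Fin 14 → ℝ} (h4 : s 4 = 0) (h6 : s 6 = 0) (h7 : s 7 = 0) (h12 : s 12 = 0)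
    (h13 : s 13 = 0) :
    Xg2 s = hmat !![s 0, s 1; s 2, s 3] (s 5) ![s 8, s 9] ![s 10, s 11] := by
  ext i j
  fin_cases i <;> fin_cases j <;> simp [Xg2, hmat, *]
  ring

lemma h3_of_Xg2 {X : M7} (hX : X ∈ g2star) (hv : X * h3 0 1 0 - h3 0 1 0 * X ∈ hIII) {A : M2}
    (hdet : A.det ≠ 0) (hA : X * h3 A 0 0 - h3 A 0 0 * X ∈ hIII)
    (h4 : (proA (X * h3 0 1 0 - h3 0 1 0 * X)).trace = 0 ∨ A.trace ≠ 0) : X ∈ hIII := by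
  obtain ⟨s, rfl⟩ := hX
  obtain ⟨h6, h7, h12, h13, hp⟩ := Xg2_of_commutator_vee hv
  obtain ⟨ht, h1, h2⟩ := Xg2_of_commutator_gl hA
  have h4' : s 4 = 0 := by
    rcases h4 with h | h
    · rw [hp] at h
      simpa using h
    · exact (mul_eq_zero.mp ht).resolve_right h
  have hu : A *ᵥ ![s 8, s 9] = 0 := by
    ext i
    fin_cases i
    · simpa [Matrix.mulVec, dotProduct] using h1
    · simpa [Matrix.mulVec, dotProduct] using h2
  have hu' := Matrix.eq_zero_of_mulVec_eq_zero hdet hu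
  exact ⟨_, _, _, by rw [Xg2_eq_hmat h4' h6 h7 h12 h13, hu', h3]⟩

section
variable {L : V7 →ₗ[ℝ] M7} {bk : V7 → V7 → V7} {a : Set M2}

lemma semidir_subset_hIII (a : Set M2) (k : ℕ) : semidir a k ⊆ hIII := by
  intro X hX
  unfold semidir at hX
  split at hX
  · obtain ⟨A, -, v, y, rfl⟩ := hX
    exact ⟨_, _, _, rfl⟩
  · obtain ⟨A, -, v, y, rfl⟩ := hX
    exact ⟨_, _, _, rfl⟩

lemma proA_mem_of_mem_semidir {k : ℕ} {X : M7} (hX : X ∈ semidir a k) : proA X ∈ a := by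
  unfold semidir at hX
  split at hX
  · obtain ⟨A, hA, v, y, rfl⟩ := hX
    rwa [proA_h3]
  · obtain ⟨A, hA, v, y, rfl⟩ := hX
    rwa [proA_h3]

lemma h3_mem_semidir {k : ℕ} {A : M2} (hA : A ∈ a) (v : ℝ) : h3 A v 0 ∈ semidir a k := by
  unfold semidir
  split
  · exact ⟨A, hA, v, 0, by congr; ext i; fin_cases i <;> rfl⟩
  · exact ⟨A, hA, v, 0, rfl⟩

lemma exists_eq_h3_of_not_isReducible (hL : ∀ x, L x ∈ hIII) (hc : CurvIII L)
    (hr : ¬ IsReducible L) : ∃ (v : ℝ) (y : Fin 2 → ℝ), L (e 3) = h3 0 v y := by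
  obtain ⟨A, v, y, hA⟩ := hL (e 3)
  by_cases h : proA (L (e 3)) = 0
  · rw [hA, proA_h3] at h
    exact ⟨v, y, by rw [hA, h]⟩
  · exact absurd (hc.isReducible hL (Or.inr h)) hr

lemma exists_eq_h3_of_sl2_subset (hbk : ∀ x y : V7, L x *ᵥ y - L y *ᵥ x = bk x y)
    (hjac : ∀ x y z : V7, bk (bk x y) z + bk (bk y z) x + bk (bk z x) y = 0)
    (hL : ∀ x, L x ∈ g2star) {k : ℕ} (hhol : (infHol L bk : Set M7) = semidir a k)
    (hsl : sl2 ⊆ a) (ha : a = sl2 ∨ 1 ∈ a) :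
    ∃ (v : ℝ) (y : Fin 2 → ℝ), L (e 3) = h3 0 v y := by
  have hmem : ∀ X, X ∈ infHol L bk ↔ X ∈ semidir a k := fun X => by
    rw [← hhol, SetLike.mem_coe]
  have hsub : ∀ X ∈ infHol L bk, X ∈ hIII := fun X hX =>
    semidir_subset_hIII a k ((hmem X).mp hX)
  have had : ∀ z, ∀ A ∈ a, ∀ v, L z * h3 A v 0 - h3 A v 0 * L z ∈ infHol L bk := fun z A hA v =>
    commutator_mem_infHol z ((hmem _).mpr (h3_mem_semidir hA v))
  have h0 : (0 : M2) ∈ a := hsl (by simp [sl2])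
  have hLmem : ∀ x, L x ∈ hIII := by
    intro x
    rcases ha with ha | ha
    · refine h3_of_Xg2 (hL x) (hsub _ (had x 0 h0 1)) (A := !![1, 0; 0, -1])
        (by simp [Matrix.det_fin_two]) (hsub _ (had x _ (hsl (by simp [sl2])) 0)) (Or.inl ?_)
      have := proA_mem_of_mem_semidir ((hmem _).mp (had x 0 h0 1))
      rw [ha] at this
      rw [Matrix.trace_fin_two]
      exact this
    · exact h3_of_Xg2 (hL x) (hsub _ (had x 0 h0 1)) (A := 1) (by simp) (hsub _ (had x _ ha 0))
        (Or.inr (by simp))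
  refine exists_eq_h3_of_not_isReducible hLmem (curvIII_of_infHol hbk hjac hsub) ?_
  rintro ⟨U, hU, hLU, N, hN, hNU⟩
  refine hNU ?_
  rw [← proA_h3 N 0 0]
  exact proA_mem_of_mem_infHol hLmem hsub hU hLU ((hmem _).mpr (h3_mem_semidir (hsl hN) 0))

end

section
variable {L : V7 →ₗ[ℝ] M7}

lemma cv_eq_sum (x z : V7) : cv L x z = ∑ m, x m • cv L (e m) z := by
  let f : V7 →ₗ[ℝ] M7 :=
    { toFun := fun x => cv L x z
      map_add' := fun x y => by
        simp only [cv, map_add, map_sub, add_mul, mul_add, Matrix.add_mulVec, Matrix.mulVec_add]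
        abel
      map_smul' := fun c x => by
        simp only [cv, map_smul, map_sub, Matrix.smul_mulVec, Matrix.mulVec_smul, smul_mul_assoc,
          mul_smul_comm, smul_sub, RingHom.id_apply] }
  exact linear_eq_sum f x

lemma proA_cv_mem {U : Submodule ℝ M2} (hU : ∀ i j, proA (cv L (e i) (e j)) ∈ U) (x y : V7) :
    proA (cv L x y) ∈ U := by
  have h : ∀ x y, (∀ i, proA (cv L (e i) y) ∈ U) → proA (cv L x y) ∈ U := by
    intro x y hi
    rw [cv_eq_sum, proA_sum]
    refine U.sum_mem fun i _ => ?_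
    rw [proA_smul]
    exact U.smul_mem _ (hi i)
  have hs : ∀ x y, proA (cv L x y) ∈ U → proA (cv L y x) ∈ U := by
    intro x y hxy
    rw [cv_swap, ← neg_one_smul ℝ, proA_smul]
    exact U.smul_mem _ hxy
  exact h x y fun i => hs _ _ (h y (e i) fun j => hU j i)

/-- The value of the `𝔤𝔩(2)`-part of the curvature when the `𝔤𝔩(2)`-parts of `L` commute. -/
lemma proA_cv_of_commute (hI : ∀ x, L x ∈ hI)
    (hc : ∀ x y, proA (L x) * proA (L y) = proA (L y) * proA (L x)) (x y : V7) :
    proA (cv L x y) = -proA (L (L x *ᵥ y - L y *ᵥ x)) := by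
  have hm : ∀ x y, proA (L x * L y) = proA (L x) * proA (L y) := fun x y => by
    obtain ⟨A, v, u, z, hx⟩ := hI x
    obtain ⟨B, w, t, z', hy⟩ := hI y
    rw [hx, hy, proA_hmat_mul, proA_hmat, proA_hmat]
  rw [cv, proA_sub, proA_sub, hm, hm, hc x y]
  simp

/-- The `𝔤𝔩(2)`-part of the curvature is closed when the `𝔤𝔩(2)`-parts of `L` commute. -/
lemma proA_cv_closed {bk : V7 → V7 → V7} (hbk : ∀ x y : V7, L x *ᵥ y - L y *ᵥ x = bk x y)
    (hjac : ∀ x y z : V7, bk (bk x y) z + bk (bk y z) x + bk (bk z x) y = 0)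
    (hI : ∀ x, L x ∈ hI)
    (hc : ∀ x y, proA (L x) * proA (L y) = proA (L y) * proA (L x)) (i j k : Fin 7) :
    ∑ m, ((L (e i) m j - L (e j) m i) • proA (cv L (e m) (e k))
      + (L (e j) m k - L (e k) m j) • proA (cv L (e m) (e i))
      + (L (e k) m i - L (e i) m k) • proA (cv L (e m) (e j))) = 0 := by
  have hR := proA_cv_of_commute hI hc
  have key : ∀ x z, proA (cv L x z) = ∑ m, x m • proA (cv L (e m) z) := fun x z => by
    rw [cv_eq_sum, proA_sum]
    simp only [proA_smul]
  have h : proA (cv L (bk (e i) (e j)) (e k)) + proA (cv L (bk (e j) (e k)) (e i))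
      + proA (cv L (bk (e k) (e i)) (e j)) = 0 := by
    rw [hR, hR, hR, hbk, hbk, hbk, ← neg_add, ← neg_add, ← proA_add, ← proA_add, ← map_add,
      ← map_add, hjac, map_zero, proA_zero, neg_zero]
  rw [key, key (bk (e j) (e k)), key (bk (e k) (e i))] at h
  simp only [← hbk, Pi.sub_apply, mulVec_e] at h
  simp only [Finset.sum_add_distrib]
  exact h

/-- If the `𝔤𝔩(2)`-part of the curvature is diagonal or conformal, it vanishes on most pairs. -/
lemma CurvIII.proA_eq_zero_of_mem (h : CurvIII L)
    (hd : (∀ i j, proA (cv L (e i) (e j)) ∈ dd) ∨ ∀ i j, proA (cv L (e i) (e j)) ∈ co2) :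
    (∀ i j : Fin 7, i < 4 → proA (cv L (e i) (e j)) = 0) ∧ proA (cv L (e 5) (e 6)) = 0 := by
  obtain ⟨⟨t1, t2, t3, t4⟩, s, ⟨a1, a2, a3, a4⟩, ⟨b1, b2, b3, b4⟩⟩ := h.proA_mixed
  have hW : proA (cv L (e 1) (e 5)) = 0 ∧ proA (cv L (e 1) (e 6)) = 0 ∧
      proA (cv L (e 2) (e 5)) = 0 ∧ proA (cv L (e 2) (e 6)) = 0 := by
    rcases hd with hd | hd
    · have h15 := hd 1 5
      have h16 := hd 1 6
      have h25 := hd 2 5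
      have h26 := hd 2 6
      simp only [dd, Set.mem_ofPred_eq] at h15 h16 h25 h26
      refine ⟨?_, ?_, ?_, ?_⟩ <;> apply mat2_eq_zero <;> grind
    · have key : ∀ i j, proA (cv L (e i) (e j)) 0 0 = proA (cv L (e i) (e j)) 1 1 ∧
          proA (cv L (e i) (e j)) 0 1 = -proA (cv L (e i) (e j)) 1 0 := by
        intro i j
        obtain ⟨a, b, hab⟩ := hd i j
        rw [hab]
        simp
      have h15 := key 1 5
      have h16 := key 1 6
      have h25 := key 2 5
      have h26 := key 2 6
      refine ⟨?_, ?_, ?_, ?_⟩ <;> apply mat2_eq_zero <;> grind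
  obtain ⟨h15, h16, h25, h26⟩ := hW
  refine ⟨fun i j hi => ?_, h.proA_dual_dual h15 h16 h25 h26⟩
  by_cases hj : j < 5
  · exact h.proA_eq_zero (by omega) hj
  · have h0 := h.proA_zero_dual
    have h3 := h.proA_three_dual
    fin_cases i <;> fin_cases j <;> simp_all

/-- The closedness relations for the two possibly nonzero `𝔤𝔩(2)`-components of the curvature. -/
lemma CurvIII.closed (h : CurvIII L) {bk : V7 → V7 → V7}
    (hbk : ∀ x y : V7, L x *ᵥ y - L y *ᵥ x = bk x y)
    (hjac : ∀ x y z : V7, bk (bk x y) z + bk (bk y z) x + bk (bk z x) y = 0)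
    (hI : ∀ x, L x ∈ hI)
    (hc : ∀ x y, proA (L x) * proA (L y) = proA (L y) * proA (L x))
    (hd : (∀ i j, proA (cv L (e i) (e j)) ∈ dd) ∨ ∀ i j, proA (cv L (e i) (e j)) ∈ co2)
    {A : Fin 7 → M2} {v : Fin 7 → ℝ} {u y : Fin 7 → Fin 2 → ℝ}
    (hL : ∀ i, L (e i) = hmat (A i) (v i) (u i) (y i)) :
    ∀ i < 4, (2 * A i 0 0 + A i 1 1) • proA (cv L (e 4) (e 5))
      + A i 0 1 • proA (cv L (e 4) (e 6)) = 0 ∧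
      (A i 0 0 + 2 * A i 1 1) • proA (cv L (e 4) (e 6))
      + A i 1 0 • proA (cv L (e 4) (e 5)) = 0 := by
  obtain ⟨hz, h56⟩ := h.proA_eq_zero_of_mem hd
  have hclosed := proA_cv_closed hbk hjac hI hc
  have h44 := h.proA_eq_zero (i := 4) (j := 4) (by decide) (by decide)
  have hz0 := hz 0
  have hz1 := hz 1
  have hz2 := hz 2
  have hz3 := hz 3
  have hz4 : ∀ i : Fin 7, i < 4 → proA (cv L (e 4) (e i)) = 0 := fun i hi =>
    h.proA_eq_zero (by decide) (by omega)
  have hneg : ∀ x y, proA (cv L x y) = -proA (cv L y x) := fun x y => by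
    rw [cv_swap, ← neg_one_smul ℝ, proA_smul, neg_one_smul]
  have h55 : ∀ i : Fin 7, proA (cv L (e i) (e i)) = 0 := fun i => by
    simp [cv, proA_zero]
  have h65 : proA (cv L (e 6) (e 5)) = 0 := by rw [hneg, h56, neg_zero]
  have hz5 : ∀ i : Fin 7, i < 4 → proA (cv L (e 5) (e i)) = 0 := fun i hi => by
    rw [hneg, hz i 5 hi, neg_zero]
  have hz6 : ∀ i : Fin 7, i < 4 → proA (cv L (e 6) (e i)) = 0 := fun i hi => by
    rw [hneg, hz i 6 hi, neg_zero]
  have h54 := hneg (e 5) (e 4)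
  have h64 := hneg (e 6) (e 4)
  refine fun i hi => ⟨?_, ?_⟩
  · have := hclosed i 4 5
    have hi' : i = 0 ∨ i = 1 ∨ i = 2 ∨ i = 3 := by omega
    rcases hi' with rfl | rfl | rfl | rfl <;>
      simp [Fin.sum_univ_succ, hL, h55, h65, h54, h64, hz0, hz1, hz2, hz3, hz4, hz5, hz6,
        hmat] at this <;>
      linear_combination (norm := module) -this
  · have := hclosed i 4 6
    have hi' : i = 0 ∨ i = 1 ∨ i = 2 ∨ i = 3 := by omega
    rcases hi' with rfl | rfl | rfl | rfl <;>
      simp [Fin.sum_univ_succ, hL, h55, h56, h54, h64, hz0, hz1, hz2, hz3, hz4, hz5, hz6,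
        hmat] at this <;>
      linear_combination (norm := module) -this
end

section
variable {L : V7 →ₗ[ℝ] M7} {bk : V7 → V7 → V7} {a : Set M2}

lemma CurvIII.proA_mem_of_mem_infHol (h : CurvIII L)
    (hbk : ∀ x y : V7, L x *ᵥ y - L y *ᵥ x = bk x y) (hI : ∀ x, L x ∈ hI)
    (hsub : ∀ X ∈ infHol L bk, X ∈ hIII)
    (hcX : ∀ z, ∀ X ∈ infHol L bk, proA (L z) * proA X = proA X * proA (L z))
    (hd : (∀ i j, proA (cv L (e i) (e j)) ∈ dd) ∨ ∀ i j, proA (cv L (e i) (e j)) ∈ co2)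
    {U : Submodule ℝ M2} (h45 : proA (cv L (e 4) (e 5)) ∈ U) (h46 : proA (cv L (e 4) (e 6)) ∈ U)
    {X : M7} (hX : X ∈ infHol L bk) : proA X ∈ U := by
  obtain ⟨hz, h56⟩ := h.proA_eq_zero_of_mem hd
  have hs : ∀ i j, proA (cv L (e i) (e j)) ∈ U → proA (cv L (e j) (e i)) ∈ U := by
    intro i j hij
    rw [cv_swap, ← neg_one_smul ℝ, proA_smul]
    exact U.smul_mem _ hij
  have h0 : ∀ i j : Fin 7, i < 4 → proA (cv L (e i) (e j)) ∈ U := fun i j hi => by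
    rw [hz i j hi]
    exact U.zero_mem
  have h56' : proA (cv L (e 5) (e 6)) ∈ U := h56 ▸ U.zero_mem
  have hii : ∀ i : Fin 7, proA (cv L (e i) (e i)) ∈ U := fun i => by
    simp [cv, proA_zero]
  have hU : ∀ i j, proA (cv L (e i) (e j)) ∈ U := by
    intro i j
    by_cases hi : i < 4
    · exact h0 i j hi
    by_cases hj : j < 4
    · exact hs _ _ (h0 j i hj)
    have hi' : i = 4 ∨ i = 5 ∨ i = 6 := by omega
    have hj' : j = 4 ∨ j = 5 ∨ j = 6 := by omega
    rcases hi' with rfl | rfl | rfl <;> rcases hj' with rfl | rfl | rfl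
    exacts [hii 4, h45, h46, hs _ _ h45, hii 5, h56', hs _ _ h46, hs _ _ h56', hii 6]
  refine infHol_le (U.comap proALin) (fun x y => ?_) (fun z X hX hXU => ?_) hX
  · change proA _ ∈ U
    rw [curv_eq_cv hbk]
    exact proA_cv_mem hU x y
  · change proA _ ∈ U
    have : proA (L z * X - X * L z) = 0 := by
      have hc := hcX z X hX
      obtain ⟨A, v, u, y, hA⟩ := hI z
      obtain ⟨B, w, t, hB⟩ := hsub X hX
      rw [hA, hB, proA_h3, proA_hmat] at hc
      rw [hA, hB, proA_sub, h3, proA_hmat_mul, proA_hmat_mul, hc, sub_self]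
    rw [this]
    exact U.zero_mem

lemma exists_eq_h3_of_dd_or_co2 (hbk : ∀ x y : V7, L x *ᵥ y - L y *ᵥ x = bk x y)
    (hjac : ∀ x y z : V7, bk (bk x y) z + bk (bk y z) x + bk (bk z x) y = 0)
    (hL : ∀ x, L x ∈ g2star) {k : ℕ} (hhol : (infHol L bk : Set M7) = semidir a k)
    (ha : a = dd ∨ a = co2) :
    ∃ (v : ℝ) (y : Fin 2 → ℝ), L (e 3) = h3 0 v y := by
  have hmem : ∀ X, X ∈ infHol L bk ↔ X ∈ semidir a k := fun X => by
    rw [← hhol, SetLike.mem_coe]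
  have hsub : ∀ X ∈ infHol L bk, X ∈ hIII := fun X hX =>
    semidir_subset_hIII a k ((hmem X).mp hX)
  have had : ∀ z, ∀ A ∈ a, ∀ v, L z * h3 A v 0 - h3 A v 0 * L z ∈ infHol L bk := fun z A hA v =>
    commutator_mem_infHol z ((hmem _).mpr (h3_mem_semidir hA v))
  have hpa : ∀ X ∈ infHol L bk, proA X ∈ a := fun X hX =>
    proA_mem_of_mem_semidir ((hmem X).mp hX)
  have h0 : (0 : M2) ∈ a := by
    rcases ha with rfl | rfl
    · simp [dd]
    · exact ⟨0, 0, by ext i j; fin_cases i <;> fin_cases j <;> simp⟩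
  have h1 : (1 : M2) ∈ a := by
    rcases ha with rfl | rfl
    · simp [dd]
    · exact ⟨1, 0, by ext i j; fin_cases i <;> fin_cases j <;> simp⟩
  have hLmem : ∀ x, L x ∈ hIII := fun x =>
    h3_of_Xg2 (hL x) (hsub _ (had x 0 h0 1)) (A := 1) (by simp) (hsub _ (had x _ h1 0))
      (Or.inr (by simp))
  have hcom : ∀ x, ∀ P ∈ a, proA (L x) * P - P * proA (L x) ∈ a := by
    intro x P hP
    have := hpa _ (had x P hP 0)
    rwa [proA_h3_commutator (hLmem x) ⟨_, _, _, rfl⟩, proA_h3] at this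
  have hLa : ∀ x, proA (L x) ∈ a := by
    intro x
    rcases ha with rfl | rfl
    · have := hcom x !![1, 0; 0, 0] (by simp [dd])
      simp [dd, Matrix.mul_apply, Matrix.vecMul, dotProduct] at this
      exact ⟨this.1, this.2⟩
    · obtain ⟨s, t, hst⟩ := hcom x !![0, -1; 1, 0] ⟨0, 1, by simp⟩
      rw [mat2_ext_iff] at hst
      simp [Matrix.mul_apply, Matrix.vecMul, dotProduct] at hst
      refine ⟨proA (L x) 0 0, proA (L x) 1 0, mat2_ext_iff.mpr ?_⟩
      simp
      constructor <;> linarith [hst.1, hst.2.1, hst.2.2.1, hst.2.2.2]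
  have hab : ∀ P ∈ a, ∀ Q ∈ a, P * Q = Q * P := by
    rcases ha with rfl | rfl
    · rintro P ⟨h1, h2⟩ Q ⟨h3, h4⟩
      rw [mat2_ext_iff]
      simp [Matrix.mul_apply, Fin.sum_univ_two, h1, h2, h3, h4, mul_comm]
    · rintro P ⟨s, t, rfl⟩ Q ⟨s', t', rfl⟩
      rw [mat2_ext_iff]
      simp [Matrix.mul_apply, Fin.sum_univ_two]
      refine ⟨?_, ?_, ?_, ?_⟩ <;> ring
  have hc : CurvIII L := curvIII_of_infHol hbk hjac hsub
  have hcva : ∀ i j, proA (cv L (e i) (e j)) ∈ a := fun i j => by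
    rw [← curv_eq_cv hbk]
    exact hpa _ (curv_mem_infHol _ _)
  have hd : (∀ i j, proA (cv L (e i) (e j)) ∈ dd) ∨ ∀ i j, proA (cv L (e i) (e j)) ∈ co2 := by
    rcases ha with rfl | rfl
    · exact Or.inl hcva
    · exact Or.inr hcva
  have hI : ∀ x, L x ∈ hI := fun x => by
    obtain ⟨A, v, y, h⟩ := hLmem x
    exact ⟨A, v, 0, y, h⟩
  have hU : ∀ U : Submodule ℝ M2, proA (cv L (e 4) (e 5)) ∈ U → proA (cv L (e 4) (e 6)) ∈ U →
      ∀ P ∈ a, P ∈ U := fun U h45 h46 P hP => by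
    rw [← proA_h3 P 0 0]
    exact hc.proA_mem_of_mem_infHol hbk hI hsub (fun z X hX => hab _ (hLa z) _ (hpa X hX)) hd h45
      h46 ((hmem _).mpr (h3_mem_semidir hP 0))
  obtain ⟨hl1, hl2⟩ := hc.proA_last
  choose A v y hA using fun i => hLmem (e i)
  have hcl := hc.closed hbk hjac hI (fun x y => hab _ (hLa x) _ (hLa y)) hd hA
  obtain ⟨hc1, hc2⟩ := hcl 3 (by decide)
  rw [mat2_ext_iff] at hc1 hc2
  have hA3 : A 3 ∈ a := by
    have := hLa (e 3)
    rwa [hA, proA_h3] at this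
  suffices h : A 3 = 0 from ⟨v 3, y 3, by rw [hA, h]⟩
  have h45 := hcva 4 5
  have h46 := hcva 4 6
  rcases ha with rfl | rfl
  · obtain ⟨h451, h452⟩ := h45
    obtain ⟨h461, h462⟩ := h46
    have hp : proA (cv L (e 4) (e 5)) 0 0 ≠ 0 := fun hp => by
      have : (!![1, 0; 0, 0] : M2) 0 0 = 0 :=
        hU (zeroEntry 0 0) hp (hl1.symm.trans h452) _ (by simp [dd])
      simp at this
    have hq : proA (cv L (e 4) (e 6)) 1 1 ≠ 0 := fun hq => by
      have : (!![0, 0; 0, 1] : M2) 1 1 = 0 :=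
        hU (zeroEntry 1 1) (hl2.trans h461) hq _ (by simp [dd])
      simp at this
    have e1 := hc1.1
    have e2 := hc2.2.2.2
    simp [hA3.1, hA3.2, hp, hq] at e1 e2
    exact mat2_eq_zero (by linarith) hA3.1 hA3.2 (by linarith)
  · obtain ⟨α, β, h45⟩ := h45
    obtain ⟨α', β', h46⟩ := h46
    obtain ⟨s, t, hst⟩ := hA3
    rw [h45, h46] at hl1 hl2 hc1
    simp at hl1 hl2
    obtain rfl := hl1
    obtain rfl := hl2
    simp [hst] at hc1
    have hne : β ^ 2 + β' ^ 2 ≠ 0 := fun h0 => by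
      have h1' : β = 0 := by nlinarith [sq_nonneg β, sq_nonneg β']
      have h2' : β' = 0 := by nlinarith [sq_nonneg β, sq_nonneg β']
      have := hU ⊥ (by simp [h45, h1', h2', mat2_ext_iff]) (by simp [h46, h1', h2', mat2_ext_iff])
        1 h1
      simp at this
    have hs : s = 0 := by
      have : (β ^ 2 + β' ^ 2) * s = 0 := by
        linear_combination (β * hc1.2.2.1 - β' * hc1.1) / 3
      exact (mul_eq_zero.mp this).resolve_left hne
    have ht : t = 0 := by
      have : (β ^ 2 + β' ^ 2) * t = 0 := by
        linear_combination -β * hc1.1 - β' * hc1.2.2.1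
      exact (mul_eq_zero.mp this).resolve_left hne
    rw [hst, hs, ht]
    simp [mat2_ext_iff]

end

section
variable {L : V7 →ₗ[ℝ] M7} {bk : V7 → V7 → V7}

lemma exists_eq_hmat_of_rdiag10 (hL : ∀ x, L x ∈ g2star) {k : ℕ}
    (hhol : (infHol L bk : Set M7) = semidir rdiag10 k) (x : V7) :
    ∃ (a d v μ : ℝ) (y : Fin 2 → ℝ), L x = hmat !![a, 0; 0, d] v ![0, μ] y := by
  have hmem : ∀ X, X ∈ infHol L bk ↔ X ∈ semidir rdiag10 k := fun X => by
    rw [← hhol, SetLike.mem_coe]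
  have hsub : ∀ X ∈ infHol L bk, X ∈ hIII := fun X hX =>
    semidir_subset_hIII rdiag10 k ((hmem X).mp hX)
  have had : ∀ A ∈ rdiag10, ∀ v, L x * h3 A v 0 - h3 A v 0 * L x ∈ infHol L bk :=
    fun A hA v => commutator_mem_infHol x ((hmem _).mpr (h3_mem_semidir hA v))
  have hE : (!![1, 0; 0, 0] : M2) ∈ rdiag10 := ⟨1, rfl⟩
  obtain ⟨s, hs⟩ := hL x
  have h1 := had 0 ⟨0, by simp [mat2_ext_iff]⟩ 1
  have h2 := had _ hE 0
  rw [← hs] at h1 h2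
  obtain ⟨h6, h7, h12, h13, -⟩ := Xg2_of_commutator_vee (hsub _ h1)
  obtain ⟨h4, h8, -⟩ := Xg2_of_commutator_gl (hsub _ h2)
  simp [Matrix.trace_fin_two] at h4 h8
  obtain ⟨t, ht⟩ := proA_mem_of_mem_semidir ((hmem _).mp h2)
  rw [Xg2_eq_hmat h4 h6 h7 h12 h13, proA_sub, h3, proA_hmat_mul, proA_hmat_mul,
    mat2_ext_iff] at ht
  simp at ht
  rw [← hs, Xg2_eq_hmat h4 h6 h7 h12 h13, h8, ht.2.1, ht.2.2]
  exact ⟨_, _, _, _, _, rfl⟩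

lemma exists_eq_h3_of_rdiag10 (hbk : ∀ x y : V7, L x *ᵥ y - L y *ᵥ x = bk x y)
    (hjac : ∀ x y z : V7, bk (bk x y) z + bk (bk y z) x + bk (bk z x) y = 0)
    (hL : ∀ x, L x ∈ g2star) {k : ℕ} (hhol : (infHol L bk : Set M7) = semidir rdiag10 k) :
    ∃ (v : ℝ) (y : Fin 2 → ℝ), L (e 3) = h3 0 v y := by
  have hmem : ∀ X, X ∈ infHol L bk ↔ X ∈ semidir rdiag10 k := fun X => by
    rw [← hhol, SetLike.mem_coe]
  have hsub : ∀ X ∈ infHol L bk, X ∈ hIII := fun X hX =>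
    semidir_subset_hIII rdiag10 k ((hmem X).mp hX)
  have hpa : ∀ X ∈ infHol L bk, proA X ∈ rdiag10 := fun X hX =>
    proA_mem_of_mem_semidir ((hmem X).mp hX)
  have hform := exists_eq_hmat_of_rdiag10 hL hhol
  have hrd : ∀ P ∈ rdiag10, P ∈ dd := by
    rintro P ⟨t, rfl⟩
    simp [dd]
  have hLd : ∀ x, proA (L x) ∈ dd := fun x => by
    obtain ⟨a, d, v, μ, y, h⟩ := hform x
    simp [h, proA_hmat, dd]
  have hab : ∀ P ∈ dd, ∀ Q ∈ dd, P * Q = Q * P := by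
    rintro P ⟨h1, h2⟩ Q ⟨h3, h4⟩
    rw [mat2_ext_iff]
    simp [Matrix.mul_apply, Fin.sum_univ_two, h1, h2, h3, h4, mul_comm]
  have hI : ∀ x, L x ∈ hI := fun x => by
    obtain ⟨a, d, v, μ, y, h⟩ := hform x
    exact ⟨_, _, _, _, h⟩
  have hc : CurvIII L := curvIII_of_infHol hbk hjac hsub
  have hcv : ∀ i j, proA (cv L (e i) (e j)) ∈ rdiag10 := fun i j => by
    rw [← curv_eq_cv hbk]
    exact hpa _ (curv_mem_infHol _ _)
  have hd := Or.inl (b := ∀ i j, proA (cv L (e i) (e j)) ∈ co2) fun i j => hrd _ (hcv i j)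
  choose a d v μ y hA using fun i => hform (e i)
  have hcl := hc.closed hbk hjac hI (fun x y => hab _ (hLd x) _ (hLd y)) hd hA
  obtain ⟨hz, -⟩ := hc.proA_eq_zero_of_mem hd
  obtain ⟨hl1, -⟩ := hc.proA_last
  obtain ⟨p, hp⟩ := hcv 4 5
  obtain ⟨q, hq⟩ := hcv 4 6
  obtain rfl : q = 0 := by
    rw [hp, hq] at hl1
    simpa using hl1.symm
  have hE : (!![1, 0; 0, 0] : M2) ∈ rdiag10 := ⟨1, rfl⟩
  have hp0 : p ≠ 0 := by
    rintro rfl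
    have := hc.proA_mem_of_mem_infHol (U := ⊥) hbk hI hsub
      (fun z X hX => hab _ (hLd z) _ (hrd _ (hpa X hX))) hd (by simp [hp, mat2_ext_iff])
      (by simp [hq, mat2_ext_iff]) ((hmem (h3 !![1, 0; 0, 0] 0 0)).mpr (h3_mem_semidir hE 0))
    simp [proA_h3, mat2_ext_iff] at this
  have hφ : ∀ i < 4, d i = -2 * a i := fun i hi => by
    have h := (hcl i hi).1
    rw [hp, hq, mat2_ext_iff] at h
    have := h.1
    simp [hp0] at this
    linarith
  have hφ0 := hφ 0 (by decide)
  have hφ1 := hφ 1 (by decide)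
  have hφ2 := hφ 2 (by decide)
  have hφ3 := hφ 3 (by decide)
  have hR := proA_cv hA
  have ha : ∀ i j, proA (cv L (e i) (e j)) 0 0 = -∑ m, (hmat !![a i, 0; 0, d i] (v i) ![0, μ i]
      (y i) m j - hmat !![a j, 0; 0, d j] (v j) ![0, μ j] (y j) m i) * a m := fun i j => by
    rw [hR]
    simp [Matrix.sum_apply, mul_comm]
  have hd' : ∀ i j, proA (cv L (e i) (e j)) 1 1 = -∑ m, (hmat !![a i, 0; 0, d i] (v i) ![0, μ i]
      (y i) m j - hmat !![a j, 0; 0, d j] (v j) ![0, μ j] (y j) m i) * d m := fun i j => by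
    rw [hR]
    simp [Matrix.sum_apply, mul_comm]
  have ha45 := ha 4 5
  have hd45 := hd' 4 5
  have ha04 := ha 0 4
  have hd04 := hd' 0 4
  have ha05 := ha 0 5
  have hd05 := hd' 0 5
  have ha34 := ha 3 4
  have hd34 := hd' 3 4
  have ha35 := ha 3 5
  have hd35 := hd' 3 5
  have ha14 := ha 1 4
  have hd14 := hd' 1 4
  have ha24 := ha 2 4
  have hd24 := hd' 2 4
  simp [Fin.sum_univ_succ, hmat, hp, hz, hφ0, hφ1, hφ2, hφ3]
    at ha45 hd45 ha04 hd04 ha05 hd05 ha34 hd34 ha35 hd35 ha14 hd14 ha24 hd24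
  have h45 : 2 * p = (a 4 + μ 5) * (2 * a 5 + d 5) - (a 5 + d 5) * (2 * a 4 + d 4) := by
    linear_combination 2 * ha45 + hd45
  have hne : ¬ (2 * a 5 + d 5 = 0 ∧ 2 * a 4 + d 4 = 0) := by
    rintro ⟨h5, h4⟩
    rw [h5, h4] at h45
    exact hp0 (by linarith)
  have h0 : a 0 = 0 := by
    by_contra h
    have h5 : 2 * a 5 + d 5 = 0 := mul_left_cancel₀ h (by linear_combination -2 * ha05 - hd05)
    exact hne ⟨h5, mul_left_cancel₀ h (by linear_combination 2 * ha04 + hd04 - μ 0 * h5)⟩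
  have h3' : a 3 = 0 := by
    by_contra h
    have h5 : 2 * a 5 + d 5 = 0 := mul_left_cancel₀ h (by linear_combination -2 * ha35 - hd35)
    exact hne ⟨h5, mul_left_cancel₀ h (by linear_combination 2 * ha34 + hd34 - μ 3 * h5)⟩
  have hμ : μ 3 = 0 := by
    by_contra h
    have h5 : 2 * a 5 + d 5 = 0 := mul_left_cancel₀ h (by
      linear_combination 2 * ha34 + hd34 - (2 * a 4 + d 4) * h3')
    have h4 : 2 * a 4 + d 4 ≠ 0 := fun h4 => hne ⟨h5, h4⟩
    have h1 : a 1 = 0 := mul_left_cancel₀ h4 (by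
      linear_combination 2 * ha14 + hd14 - μ 1 * h5)
    have h2 : a 2 = 0 := mul_left_cancel₀ h4 (by
      linear_combination 2 * ha24 + hd24 - μ 2 * h5)
    have ha5 : a 5 = 0 := mul_left_cancel₀ h (by simpa [h0, h1, h2, h3'] using ha34)
    have hd5 : d 5 = 0 := by linarith
    rw [h5, ha5, hd5] at h45
    exact hp0 (by linarith)
  refine ⟨v 3, y 3, ?_⟩
  rw [hA, hφ3, h3', hμ, h3]
  congr 1
  · simp [mat2_ext_iff]
  · ext i
    fin_cases i <;> rfl

end

theorem stmt16 (bk : V7 → V7 → V7) (L : V7 →ₗ[ℝ] M7)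
    (hbk : ∀ x y : V7, (L x).mulVec y - (L y).mulVec x = bk x y)
    (halt : ∀ x : V7, bk x x = 0)
    (hjac : ∀ x y z : V7, bk (bk x y) z + bk (bk y z) x + bk (bk z x) y = 0)
    (hL : ∀ x, L x ∈ g2star)
    (a : Set M2) (k : ℕ) (hak : ListedPair a k) (ha : a ≠ ({0} : Set M2))
    (hhol : (infHol L bk : Set M7) = semidir a k) :
    ∃ (v : ℝ) (y : Fin 2 → ℝ), L (e 3) = h3 0 v y := by
  rcases hak with ⟨rfl | rfl | rfl | rfl, -⟩ | ⟨rfl | rfl, -⟩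
  · exact exists_eq_h3_of_sl2_subset hbk hjac hL hhol subset_rfl (Or.inl rfl)
  · exact exists_eq_h3_of_sl2_subset hbk hjac hL hhol (Set.subset_univ _) (Or.inr trivial)
  · exact exists_eq_h3_of_dd_or_co2 hbk hjac hL hhol (Or.inr rfl)
  · exact exists_eq_h3_of_dd_or_co2 hbk hjac hL hhol (Or.inl rfl)
  · exact absurd rfl ha
  · exact exists_eq_h3_of_rdiag10 hbk hjac hL hhol
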